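/- Assume G ≅ C_{n1} ⊕ … ⊕ C_{nr} with 1 < n1 | … | nr and D(G) ≥ 4, and let G' be a finite abelian group with 𝓛(G) = 𝓛(G'). If r ≤ nr − 3 and Δ*(G) is an interval (a set of consecutive integers), then exp(G) = exp(G') and r(G) = r(G'). -/

import Mathlib

/- Common definitions: zero-sum sequences over a finite abelian group,
   sets of lengths, the system of sets of lengths, the Davenport constant,
   sets of distances, elasticities, AAPs, Δ₁(G), ρ(G,d,k), ρ(G,d), ρ*(G,d),
   cross numbers, K(G₀), K(G,d), LCN-sets, Δ*(G). -/

open scoped Classical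

section Defs

variable {G : Type*} [AddCommGroup G]

/-- The support of a sequence (multiset) over `G`. -/
def suppSet (A : Multiset G) : Set G := {g | g ∈ A}

/-- `A` is a minimal zero-sum sequence (an atom of `𝓑(G₀)`) over `G₀ ⊆ G`:
a nontrivial zero-sum sequence with terms in `G₀` such that every proper
nontrivial subsequence has nonzero sum. -/
def IsMinZeroSum (G0 : Set G) (A : Multiset G) : Prop :=
  A ≠ 0 ∧ (∀ g ∈ A, g ∈ G0) ∧ A.sum = 0 ∧
    ∀ T : Multiset G, T ≤ A → T.sum = 0 → T = 0 ∨ T = A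

/-- `B` is a zero-sum sequence over `G₀ ⊆ G` (an element of `𝓑(G₀)`). -/
def IsZeroSumSeq (G0 : Set G) (B : Multiset G) : Prop :=
  (∀ g ∈ B, g ∈ G0) ∧ B.sum = 0

/-- The set of lengths `L(B)` of a zero-sum sequence `B` over `G₀`:
all `k` such that `B` is a product of `k` atoms of `𝓑(G₀)`.
(For the trivial sequence this is `{0}`.) -/
def lengthSet (G0 : Set G) (B : Multiset G) : Set ℕ :=
  {k | ∃ U : Fin k → Multiset G, (∀ i, IsMinZeroSum G0 (U i)) ∧ B = ∑ i, U i}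

/-- The system of sets of lengths `𝓛(G₀)`. -/
def systemL (G0 : Set G) : Set (Set ℕ) :=
  {L | ∃ B : Multiset G, IsZeroSumSeq G0 B ∧ L = lengthSet G0 B}

/-- The Davenport constant `D(G)`: the maximal length of a minimal zero-sum
sequence over `G`. -/
noncomputable def davenport (G : Type*) [AddCommGroup G] : ℕ :=
  sSup {m | ∃ A : Multiset G, IsMinZeroSum (Set.univ : Set G) A ∧ Multiset.card A = m}

/-- The set of successive distances `Δ(L)` of a set `L ⊆ ℕ`. -/
def deltaOf (L : Set ℕ) : Set ℕ :=
  {d | 0 < d ∧ ∃ a, a ∈ L ∧ a + d ∈ L ∧ ∀ c ∈ L, ¬(a < c ∧ c < a + d)}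

/-- `Δ(G₀) = ⋃_{L ∈ 𝓛(G₀)} Δ(L)`. -/
def deltaG0 (G0 : Set G) : Set ℕ := ⋃ L ∈ systemL G0, deltaOf L

/-- `Δ*(G) = {min Δ(G₀) : G₀ ⊆ G with Δ(G₀) ≠ ∅}`. -/
def deltaStar (G : Type*) [AddCommGroup G] : Set ℕ :=
  {d | ∃ G0 : Set G, deltaG0 G0 ≠ ∅ ∧ d = sInf (deltaG0 G0)}

/-- The elasticity `ρ(L) = max L / min L` of a (finite) set `L ⊆ ℕ`,
with the convention `ρ({0}) = 1`. -/
noncomputable def rhoL (L : Set ℕ) : ℝ :=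
  if sInf L = 0 then 1 else ((sSup L : ℕ) : ℝ) / ((sInf L : ℕ) : ℝ)

/-- The elasticity `ρ(G₀) = sup {ρ(L) : L ∈ 𝓛(G₀)}`. -/
noncomputable def rhoG0 (G0 : Set G) : ℝ := sSup (rhoL '' systemL G0)

/-- `L` (a set of naturals) is an almost arithmetical progression (AAP)
with difference `d`, length `ℓ` and bound `M`:
`L = y + (L' ∪ {0, d, …, ℓd} ∪ L'') ⊆ y + dℤ` with `L' ⊆ [−M, −1]` and
`L'' ⊆ ℓd + [1, M]`. -/
def IsAAP (L : Set ℕ) (d ℓ M : ℕ) : Prop :=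
  ∃ (y : ℤ) (L1 L2 : Set ℤ),
    L1 ⊆ Set.Icc (-(M : ℤ)) (-1) ∧
    L2 ⊆ Set.Icc ((ℓ : ℤ) * d + 1) ((ℓ : ℤ) * d + M) ∧
    ((fun x : ℕ => (x : ℤ)) '' L) =
      (fun x => y + x) '' (L1 ∪ (fun i : ℤ => (d : ℤ) * i) '' Set.Icc (0 : ℤ) (ℓ : ℤ) ∪ L2) ∧
    (∀ x ∈ L, (d : ℤ) ∣ ((x : ℤ) - y))

/-- `Δ₁(G)`: the set of `d ∈ ℕ` such that for every `k` there is some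
`L ∈ 𝓛(G)` which is an AAP with difference `d` and length at least `k`. -/
def delta1 (G : Type*) [AddCommGroup G] : Set ℕ :=
  {d | 0 < d ∧ ∀ k : ℕ, ∃ L ∈ systemL (Set.univ : Set G), ∃ ℓ ≥ k, ∃ M : ℕ, IsAAP L d ℓ M}

/-- `ρ(G, d, k)`: the supremum of elasticities of sets of lengths of `G` which
are AAPs with difference `d` and length at least `k`. -/
noncomputable def rhoGdk (G : Type*) [AddCommGroup G] (d k : ℕ) : ℝ :=
  sSup (rhoL '' {L | L ∈ systemL (Set.univ : Set G) ∧ ∃ ℓ ≥ k, ∃ M : ℕ, IsAAP L d ℓ M})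

/-- `ρ(G, d)`: the limit of the decreasing sequence `(ρ(G, d, k))_k`,
i.e. its infimum. -/
noncomputable def rhoGd (G : Type*) [AddCommGroup G] (d : ℕ) : ℝ :=
  ⨅ k : ℕ, rhoGdk G d k

/-- `ρ*(G, d) = max {ρ(G₀) : G₀ ⊆ G non-half-factorial with d ∣ min Δ(G₀)}`. -/
noncomputable def rhoStar (G : Type*) [AddCommGroup G] (d : ℕ) : ℝ :=
  sSup {x | ∃ G0 : Set G, deltaG0 G0 ≠ ∅ ∧ d ∣ sInf (deltaG0 G0) ∧ x = rhoG0 G0}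

/-- The cross number `k(S) = Σ_{g ∈ S} 1/ord(g)` of a sequence `S`. -/
noncomputable def crossNum (S : Multiset G) : ℝ :=
  (S.map (fun g => (1 : ℝ) / (addOrderOf g))).sum

/-- `K(G₀) = max {k(A) : A ∈ 𝓐(G₀)}`, the cross number of `G₀`. -/
noncomputable def KG0 (G0 : Set G) : ℝ :=
  sSup {x | ∃ A : Multiset G, IsMinZeroSum G0 A ∧ x = crossNum A}

/-- `K(G, d) = max {K(G₀) : G₀ ⊆ G non-half-factorial with d ∣ min Δ(G₀)}`. -/
noncomputable def KGd (G : Type*) [AddCommGroup G] (d : ℕ) : ℝ :=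
  sSup {x | ∃ G0 : Set G, deltaG0 G0 ≠ ∅ ∧ d ∣ sInf (deltaG0 G0) ∧ x = KG0 G0}

/-- `G₀` is an LCN-set: `k(A) ≥ 1` for every atom `A` of `𝓑(G₀)`. -/
def IsLCN (G0 : Set G) : Prop :=
  ∀ A : Multiset G, IsMinZeroSum G0 A → 1 ≤ crossNum A

end Defs

open scoped Classical

/-! ### Basic facts on factorizations -/

section Basic

variable {G : Type*} [AddCommGroup G]

/-- Atoms over the full group. -/
def Atom (U : Multiset G) : Prop := IsMinZeroSum (Set.univ : Set G) U

/-- A multiset of atoms. -/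
def Fctn (F : Multiset (Multiset G)) : Prop := ∀ U ∈ F, Atom U

/-- Terms in `S`. -/
def Over (S : Set G) (B : Multiset G) : Prop := ∀ g ∈ B, g ∈ S

/-- `B` has a factorization of length `k`. -/
def HasLen (B : Multiset G) (k : ℕ) : Prop := ∃ F, Fctn F ∧ F.sum = B ∧ Multiset.card F = k

lemma Atom.ne_zero {U : Multiset G} (h : Atom U) : U ≠ 0 := h.1
lemma Atom.sum {U : Multiset G} (h : Atom U) : U.sum = 0 := h.2.2.1
lemma Atom.eq_of_le {U T : Multiset G} (h : Atom U) (hT : T ≤ U) (h0 : T ≠ 0)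
    (hs : T.sum = 0) : T = U := (h.2.2.2 T hT hs).resolve_left h0

lemma Atom.mk' {U : Multiset G} (h0 : U ≠ 0) (hs : U.sum = 0)
    (h : ∀ T ≤ U, T.sum = 0 → T = 0 ∨ T = U) : Atom U :=
  ⟨h0, fun _ _ => trivial, hs, h⟩

lemma Fctn.zero : Fctn (0 : Multiset (Multiset G)) := by intro U hU; simp at hU

lemma Fctn.add {F1 F2 : Multiset (Multiset G)} (h1 : Fctn F1) (h2 : Fctn F2) :
    Fctn (F1 + F2) := by
  intro U hU
  rcases Multiset.mem_add.1 hU with h | h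
  · exact h1 U h
  · exact h2 U h

lemma Fctn.cons {F : Multiset (Multiset G)} {U : Multiset G} (h1 : Atom U) (h2 : Fctn F) :
    Fctn (U ::ₘ F) := by
  intro V hV
  rcases Multiset.mem_cons.1 hV with h | h
  · rw [h]; exact h1
  · exact h2 V h

lemma Fctn.mono {F F' : Multiset (Multiset G)} (h : Fctn F) (hle : F' ≤ F) : Fctn F' :=
  fun U hU => h U (Multiset.mem_of_le hle hU)

lemma Fctn.sum_sum {F : Multiset (Multiset G)} (h : Fctn F) : F.sum.sum = 0 := by
  induction F using Multiset.induction_on with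
  | empty => simp
  | cons U F ih =>
    rw [Multiset.sum_cons, Multiset.sum_add, (h U (by simp)).sum,
      ih (h.mono (Multiset.le_cons_self _ _)), add_zero]

lemma fact_replicate {U : Multiset G} (h : Atom U) (k : ℕ) : Fctn (Multiset.replicate k U) := by
  intro V hV; rw [Multiset.eq_of_mem_replicate hV]; exact h

lemma mem_lengthSet {B : Multiset G} {k : ℕ} :
    k ∈ lengthSet (Set.univ : Set G) B ↔ HasLen B k := by
  constructor
  · rintro ⟨U, hU, rfl⟩
    refine ⟨Finset.univ.val.map U, ?_, rfl, by simp⟩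
    intro V hV
    obtain ⟨i, -, rfl⟩ := Multiset.mem_map.1 hV
    exact hU i
  · rintro ⟨F, hF, rfl, rfl⟩
    induction F using Quotient.inductionOn with
    | h l =>
      refine ⟨fun i => l.get i, fun i => hF _ ?_, ?_⟩
      · exact Multiset.mem_coe.2 (List.get_mem l i)
      · have := (List.sum_ofFn (f := fun i : Fin l.length => l.get i))
        rw [List.ofFn_get] at this
        exact (Multiset.sum_coe l).trans this

lemma HasLen.add {A B : Multiset G} {a b : ℕ} (hA : HasLen A a) (hB : HasLen B b) :
    HasLen (A + B) (a + b) := by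
  obtain ⟨F, hF, rfl, rfl⟩ := hA
  obtain ⟨F', hF', rfl, rfl⟩ := hB
  exact ⟨F + F', hF.add hF', by simp, by simp⟩

lemma HasLen.nsmul {A : Multiset G} {a : ℕ} (hA : HasLen A a) (k : ℕ) :
    HasLen (k • A) (k * a) := by
  induction k with
  | zero => exact ⟨0, Fctn.zero, by simp, by simp⟩
  | succ k ih => rw [succ_nsmul, add_mul, one_mul]; exact ih.add hA

lemma HasLen.atom {U : Multiset G} (h : Atom U) : HasLen U 1 :=
  ⟨{U}, by intro V hV; rw [Multiset.mem_singleton.1 hV]; exact h, by simp, by simp⟩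

lemma sum_sub_zero {A T : Multiset G} (h : T ≤ A) (hA : A.sum = 0) (hT : T.sum = 0) :
    (A - T).sum = 0 := by
  have : A - T + T = A := tsub_add_cancel_of_le h
  have h2 := congrArg Multiset.sum this
  rwa [Multiset.sum_add, hT, add_zero, hA] at h2

lemma exists_atom_le {B : Multiset G} (h0 : B ≠ 0) (hs : B.sum = 0) : ∃ U ≤ B, Atom U := by
  induction hc : Multiset.card B using Nat.strong_induction_on generalizing B with
  | _ c ih =>
    by_cases h : ∀ T ≤ B, T.sum = 0 → T = 0 ∨ T = B
    · exact ⟨B, le_rfl, Atom.mk' h0 hs h⟩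
    · push Not at h
      obtain ⟨T, hT, hTs, hT0, hTB⟩ := h
      have : Multiset.card T < c := by
        rw [← hc]; exact Multiset.card_lt_card (lt_of_le_of_ne hT hTB)
      obtain ⟨U, hU, hA⟩ := ih _ this hT0 hTs rfl
      exact ⟨U, hU.trans hT, hA⟩

lemma exists_fact {B : Multiset G} (hs : B.sum = 0) : ∃ F, Fctn F ∧ F.sum = B := by
  induction hc : Multiset.card B using Nat.strong_induction_on generalizing B with
  | _ c ih =>
    by_cases h0 : B = 0
    · exact ⟨0, Fctn.zero, by simp [h0]⟩
    · obtain ⟨U, hU, hA⟩ := exists_atom_le h0 hs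
      have hlt : Multiset.card (B - U) < c := by
        have h1 := Multiset.card_pos.2 hA.ne_zero
        have h2 := Multiset.card_le_card hU
        rw [Multiset.card_sub hU]; omega
      obtain ⟨F, hF, hFs⟩ := ih _ hlt (sum_sub_zero hU hs hA.sum) rfl
      refine ⟨U ::ₘ F, Fctn.cons hA hF, ?_⟩
      rw [Multiset.sum_cons, hFs]
      exact add_tsub_cancel_of_le hU

lemma Over.mono {S T : Set G} {B : Multiset G} (h : Over S B) (hST : S ⊆ T) : Over T B :=
  fun g hg => hST (h g hg)

lemma Over.le {S : Set G} {B C : Multiset G} (h : Over S B) (hc : C ≤ B) : Over S C :=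
  fun g hg => h g (Multiset.mem_of_le hc hg)

lemma Over.add {S : Set G} {B C : Multiset G} (h : Over S B) (hc : Over S C) : Over S (B + C) := by
  intro g hg
  rcases Multiset.mem_add.1 hg with h' | h'
  · exact h g h'
  · exact hc g h'

lemma Over.nsmul {S : Set G} {B : Multiset G} (h : Over S B) (k : ℕ) : Over S (k • B) := by
  intro g hg
  exact h g (Multiset.mem_of_mem_nsmul hg)

lemma Over.mem_fact {S : Set G} {F : Multiset (Multiset G)} (h : Over S F.sum) {U : Multiset G}
    (hU : U ∈ F) : Over S U := h.le (Multiset.le_sum_of_mem hU)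

/-- All lengths of elements over `S` are congruent modulo `d`. -/
def Modd (d : ℕ) (S : Set G) : Prop := ∀ (B : Multiset G) (a b : ℕ), Over S B →
  HasLen B a → HasLen B b → (d : ℤ) ∣ (a : ℤ) - b

/-- Not half-factorial. -/
def NonHF (S : Set G) : Prop := ∃ (B : Multiset G) (a b : ℕ), Over S B ∧
  HasLen B a ∧ HasLen B b ∧ a ≠ b

lemma Modd.mono {d : ℕ} {S T : Set G} (h : Modd d T) (hST : S ⊆ T) : Modd d S :=
  fun B a b hB => h B a b (hB.mono hST)

/-- The pure power of `g`. -/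
noncomputable def pw (g : G) : Multiset G := Multiset.replicate (addOrderOf g) g

/-- `n` times the cross number. -/
noncomputable def wt (n : ℕ) (B : Multiset G) : ℕ := (B.map (fun g => n / addOrderOf g)).sum

@[simp] lemma wt_zero (n : ℕ) : wt n (0 : Multiset G) = 0 := by simp [wt]
@[simp] lemma wt_add (n : ℕ) (A B : Multiset G) : wt n (A + B) = wt n A + wt n B := by simp [wt]
@[simp] lemma wt_cons (n : ℕ) (g : G) (B : Multiset G) :
    wt n (g ::ₘ B) = n / addOrderOf g + wt n B := by simp [wt]
@[simp] lemma wt_nsmul (n k : ℕ) (A : Multiset G) : wt n (k • A) = k * wt n A := by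
  simp [wt, Multiset.map_nsmul, Multiset.sum_nsmul]

lemma wt_sum (n : ℕ) (F : Multiset (Multiset G)) : wt n F.sum = (F.map (wt n)).sum := by
  induction F using Multiset.induction_on with
  | empty => simp
  | cons U F ih => simp [ih]

lemma wt_mono (n : ℕ) {A B : Multiset G} (h : A ≤ B) : wt n A ≤ wt n B := by
  obtain ⟨C, rfl⟩ := Multiset.le_iff_exists_add.1 h
  simp

end Basic

section Fin

variable {G : Type*} [AddCommGroup G] [Finite G]

lemma ord_pos (g : G) : 0 < addOrderOf g := addOrderOf_pos g

lemma pw_sum (g : G) : (pw g).sum = 0 := by simp [pw]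

lemma pw_ne_zero (g : G) : pw g ≠ 0 := by
  intro h
  have := congrArg Multiset.card h
  rw [pw, Multiset.card_replicate, Multiset.card_zero] at this
  exact (ord_pos g).ne' this

lemma pw_atom (g : G) : Atom (pw g) := by
  refine Atom.mk' (pw_ne_zero g) (pw_sum g) ?_
  intro T hT hs
  obtain ⟨k, hk, rfl⟩ := Multiset.le_replicate_iff.1 hT
  rw [Multiset.sum_replicate] at hs
  have hd := addOrderOf_dvd_of_nsmul_eq_zero hs
  rcases Nat.eq_zero_or_pos k with h | h
  · left; simp [h]
  · right
    have : k = addOrderOf g := le_antisymm hk (Nat.le_of_dvd h hd)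
    rw [pw, this]

lemma pw_le_iff {g : G} {B : Multiset G} : pw g ≤ B ↔ addOrderOf g ≤ B.count g := by
  rw [pw, Multiset.le_count_iff_replicate_le]

lemma pw_over {S : Set G} {g : G} (h : g ∈ S) : Over S (pw g) := by
  intro x hx; rw [Multiset.eq_of_mem_replicate hx]; exact h

variable {n : ℕ} 

lemma ord_dvd (hexp : ∀ g : G, n • g = 0) (g : G) : addOrderOf g ∣ n :=
  addOrderOf_dvd_of_nsmul_eq_zero (hexp g)

lemma wt_pw (hexp : ∀ g : G, n • g = 0) (g : G) : wt n (pw g) = n := by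
  simp only [wt, pw, Multiset.map_replicate, Multiset.sum_replicate, smul_eq_mul]
  exact Nat.mul_div_cancel' (ord_dvd hexp g)

lemma one_le_wt1 (hn : 0 < n) (hexp : ∀ g : G, n • g = 0) (g : G) : 1 ≤ n / addOrderOf g :=
  Nat.div_pos (Nat.le_of_dvd hn (ord_dvd hexp g)) (ord_pos g)

lemma card_le_wt (hn : 0 < n) (hexp : ∀ g : G, n • g = 0) (B : Multiset G) :
    Multiset.card B ≤ wt n B := by
  induction B using Multiset.induction_on with
  | empty => simp
  | cons g B ih => have := one_le_wt1 hn hexp g; simp; omega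

lemma wt_le (B : Multiset G) : wt n B ≤ n * Multiset.card B := by
  induction B using Multiset.induction_on with
  | empty => simp
  | cons g B ih => 
    have := Nat.div_le_self n (addOrderOf g)
    simp [mul_add]; omega

lemma hasLen_nsmul_wt (hexp : ∀ g : G, n • g = 0) (B : Multiset G) :
    HasLen (n • B) (wt n B) := by
  induction B using Multiset.induction_on with
  | empty => exact ⟨0, Fctn.zero, by simp, by simp⟩
  | cons g B ih =>
    rw [wt_cons, ← Multiset.singleton_add, nsmul_add]
    refine HasLen.add ?_ ih
    have h := (HasLen.atom (pw_atom g)).nsmul (n / addOrderOf g)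
    rw [mul_one] at h
    convert h using 1
    rw [pw, Multiset.nsmul_replicate, Nat.div_mul_cancel (ord_dvd hexp g),
      Multiset.nsmul_singleton]

lemma hasLen_nsmul_atom {U : Multiset G} (hU : Atom U) (k : ℕ) : HasLen (k • U) k := by
  simpa using (HasLen.atom hU).nsmul k

lemma wt_eq_of_hf (hexp : ∀ g : G, n • g = 0) {S : Set G} (hS : ¬ NonHF S) {U : Multiset G}
    (hU : Atom U) (hO : Over S U) : wt n U = n := by
  by_contra h
  exact hS ⟨n • U, wt n U, n, hO.nsmul n, hasLen_nsmul_wt hexp U, hasLen_nsmul_atom hU n, h⟩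

lemma sum_map_const_of {F : Multiset (Multiset G)} (h : ∀ U ∈ F, wt n U = n) :
    wt n F.sum = n * Multiset.card F := by
  rw [wt_sum, Multiset.map_congr rfl h]; simp [mul_comm]

lemma hf_of_wt_eq (hn : 0 < n) {S : Set G}
    (h : ∀ U, Atom U → Over S U → wt n U = n) : ¬ NonHF S := by
  rintro ⟨B, a, b, hB, ⟨F, hF, rfl, rfl⟩, ⟨F', hF', hs, rfl⟩, hne⟩
  have h1 := sum_map_const_of (n := n) (F := F) (fun U hU => h U (hF U hU) (hB.mem_fact hU))
  have h2 := sum_map_const_of (n := n) (F := F')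
    (fun U hU => h U (hF' U hU) ((hs ▸ hB).mem_fact hU))
  rw [hs, h1] at h2
  exact hne (Nat.eq_of_mul_eq_mul_left hn h2)

/-- In a factorization with all weights at least `t`. -/
lemma card_mul_le_wt {t : ℕ} {F : Multiset (Multiset G)} (h : ∀ U ∈ F, t ≤ wt n U) :
    Multiset.card F * t ≤ wt n F.sum := by
  rw [wt_sum]
  have := Multiset.card_nsmul_le_sum (s := F.map (wt n)) (a := t) (by
    intro x hx; obtain ⟨U, hU, rfl⟩ := Multiset.mem_map.1 hx; exact h U hU)
  simpa using this

lemma count_lt_of_atom {U : Multiset G} (hU : Atom U) {g : G} (h : U ≠ pw g) :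
    U.count g < addOrderOf g := by
  by_contra hc
  push Not at hc
  exact h (hU.eq_of_le (pw_le_iff.2 hc) (pw_ne_zero g) (pw_sum g)).symm

end Fin

open scoped Classical

section LCN

variable {G : Type*} [AddCommGroup G] [Fintype G]

/-- The multiset with given multiplicities. -/
noncomputable def mkM (f : G → ℕ) : Multiset G := ∑ g, Multiset.replicate (f g) g

lemma count_mkM (f : G → ℕ) (g : G) : (mkM f).count g = f g := by
  rw [mkM, Multiset.count_sum']
  simp [Multiset.count_replicate]

lemma mem_mkM {f : G → ℕ} {g : G} : g ∈ mkM f ↔ f g ≠ 0 := by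
  rw [← Multiset.count_ne_zero, count_mkM]

lemma sum_eq_count (B : Multiset G) : B.sum = ∑ g, B.count g • g := by
  rw [Finset.sum_multiset_count]
  refine Finset.sum_subset (Finset.subset_univ _) ?_
  intro x _ hx
  rw [Multiset.mem_toFinset] at hx
  rw [Multiset.count_eq_zero_of_notMem hx, zero_smul]

lemma sum_mkM (f : G → ℕ) : (mkM f).sum = ∑ g, f g • g := by
  rw [sum_eq_count]; simp [count_mkM]

lemma small_case {n d : ℕ} (hn : 0 < n) (hexp : ∀ g : G, n • g = 0) {S : Set G} (hmod : Modd d S)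
    (hlcn : ∀ U : Multiset G, Atom U → Over S U → n ≤ wt n U) {U : Multiset G} (hU : Atom U)
    (hO : Over S U) (hw : n < wt n U) : d + 2 ≤ U.toFinset.card := by
  set P : Multiset G := ∑ h ∈ U.toFinset, pw h with hP
  have hne : ∀ g, U ≠ pw g := by
    intro g h; rw [h, wt_pw hexp] at hw; exact lt_irrefl _ hw
  have hcount : ∀ g, P.count g = if g ∈ U then addOrderOf g else 0 := by
    intro g
    rw [hP, Multiset.count_sum']
    simp [pw, Multiset.count_replicate]
  have hle : U ≤ P := by
    rw [Multiset.le_iff_count]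
    intro g
    rw [hcount]
    split_ifs with h
    · exact (count_lt_of_atom hU (hne g)).le
    · rw [Multiset.count_eq_zero_of_notMem h]
  have hPl : HasLen P U.toFinset.card := by
    refine ⟨U.toFinset.val.map pw, ?_, rfl, Multiset.card_map _ _⟩
    intro V hV
    obtain ⟨g, -, rfl⟩ := Multiset.mem_map.1 hV
    exact pw_atom g
  have hPO : Over S P := by
    intro g hg
    rw [← Multiset.count_ne_zero, hcount] at hg
    by_cases h : g ∈ U
    · exact hO g h
    · simp [h] at hg
  have hPs : P.sum = 0 := by
    obtain ⟨F, hF, h, -⟩ := hPl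
    rw [← h]; exact hF.sum_sum
  have hPw : wt n P = n * U.toFinset.card := by
    have : P = (U.toFinset.val.map pw).sum := rfl
    rw [this, sum_map_const_of]
    · rw [Multiset.card_map]; rfl
    · intro V hV
      obtain ⟨g, -, rfl⟩ := Multiset.mem_map.1 hV
      exact wt_pw hexp g
  obtain ⟨F, hF, hFs⟩ := exists_fact (sum_sub_zero hle hPs hU.sum)
  have hUP : U + F.sum = P := by rw [hFs]; exact add_tsub_cancel_of_le hle
  have hFO : Over S F.sum := by rw [hFs]; exact hPO.le tsub_le_self
  have h1 := card_mul_le_wt (n := n) (t := n) (F := F)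
    (fun V hV => hlcn V (hF V hV) (hFO.mem_fact hV))
  have h2 : wt n U + wt n F.sum = n * U.toFinset.card := by rw [← wt_add, hUP, hPw]
  have h3 : HasLen P (1 + Multiset.card F) := by
    rw [← hUP]; exact (HasLen.atom hU).add ⟨F, hF, rfl, rfl⟩
  have h4 := hmod P _ _ hPO hPl h3
  have hF0 : 0 < Multiset.card F := by
    rw [Multiset.card_pos]
    rintro rfl
    rw [Multiset.sum_zero, add_zero] at hUP
    obtain ⟨g, hg⟩ := Multiset.exists_mem_of_ne_zero hU.ne_zero
    have := hcount g
    rw [← hUP, if_pos hg] at this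
    have := count_lt_of_atom hU (hne g)
    omega
  have h5 : Multiset.card F + 1 < U.toFinset.card := by
    have : n * (Multiset.card F + 1) < n * U.toFinset.card := by
      rw [← h2, mul_add, mul_comm n, mul_one]; omega
    exact Nat.lt_of_mul_lt_mul_left this
  have h6 := Int.le_of_dvd (by push_cast; omega) h4
  push_cast at h6
  omega

lemma mem_closure_repr {E : Finset G} {y : G} (hy : y ∈ AddSubgroup.closure (E : Set G)) :
    ∃ z : G → ℤ, (∀ g, z g ≠ 0 → g ∈ E) ∧ y = ∑ g, z g • g := by
  induction hy using AddSubgroup.closure_induction with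
  | mem x hx =>
    refine ⟨Pi.single x 1, ?_, ?_⟩
    · intro g hg
      by_cases h : g = x
      · rw [h]; exact hx
      · simp [h] at hg
    · rw [Finset.sum_eq_single x]
      · simp
      · intro b _ hb; simp [hb]
      · simp
  | zero => exact ⟨0, by simp, by simp⟩
  | add x y _ _ hx hy =>
    obtain ⟨z, hz, rfl⟩ := hx
    obtain ⟨z', hz', rfl⟩ := hy
    refine ⟨z + z', ?_, ?_⟩
    · intro g hg
      by_cases h : z g = 0
      · refine hz' g ?_
        intro h'; simp [h, h'] at hg
      · exact hz g h
    · simp [add_smul, Finset.sum_add_distrib]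
  | neg x _ hx =>
    obtain ⟨z, hz, rfl⟩ := hx
    refine ⟨-z, ?_, by simp⟩
    intro g hg; exact hz g (by simpa using hg)

lemma dep {s p : ℕ} (hp : 1 < p) (htor : Nat.card {x : G // p • x = 0} ≤ p ^ s)
    {E : Finset G} (hE : E.card = s + 1) :
    ∃ x : G → ℤ, (∀ g, x g ≠ 0 → g ∈ E) ∧ ∑ g, x g • g = 0 ∧ ∃ g ∈ E, ¬ (p : ℤ) ∣ x g := by
  set H := AddSubgroup.closure (E : Set G) with hH
  let φ : H →+ H := nsmulAddMonoidHom p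
  have hcard : Nat.card (H ⧸ φ.range) ≤ p ^ s := by
    have h1 : Nat.card (H ⧸ φ.range) = Nat.card φ.ker := by
      have e1 := AddSubgroup.card_mul_index φ.ker
      have e2 := AddSubgroup.card_mul_index φ.range
      rw [AddSubgroup.index_ker] at e1
      have : 0 < Nat.card φ.range := Nat.card_pos
      rw [← e1, mul_comm] at e2
      have := Nat.eq_of_mul_eq_mul_right this e2
      rw [← this]; rfl
    rw [h1]
    refine le_trans ?_ htor
    refine Nat.card_le_card_of_injective
      (fun x : φ.ker => (⟨((x : H) : G), ?_⟩ : {x : G // p • x = 0})) ?_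
    · have := x.2
      rw [AddMonoidHom.mem_ker] at this
      have := congrArg (fun y : H => (y : G)) this
      simpa [φ] using this
    · intro x y hxy
      simp only [Subtype.mk.injEq] at hxy
      exact Subtype.ext (Subtype.ext hxy)
  have hmem : ∀ g : E, (g : G) ∈ H := fun g => AddSubgroup.subset_closure g.2
  let c : (E → Fin p) → H ⧸ φ.range := fun a => 
    QuotientAddGroup.mk (∑ g : E, (a g : ℕ) • (⟨g, hmem g⟩ : H))
  haveI : Fintype (H ⧸ φ.range) := Fintype.ofFinite _
  have hlt : Fintype.card (H ⧸ φ.range) < Fintype.card (E → Fin p) := by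
    rw [← Nat.card_eq_fintype_card]
    refine lt_of_le_of_lt hcard ?_
    simp only [Fintype.card_pi, Fintype.card_fin, Finset.prod_const, Finset.card_univ,
      Fintype.card_coe, hE]
    exact Nat.pow_lt_pow_right hp (Nat.lt_succ_self s)
  obtain ⟨a, b, hab, hc⟩ := Fintype.exists_ne_map_eq_of_card_lt c hlt
  have hc' := QuotientAddGroup.eq.1 hc
  obtain ⟨y, hy⟩ := hc'
  obtain ⟨z, hz, hyz⟩ := mem_closure_repr y.2
  have hy' : (p : ℕ) • (y : G) = -(∑ g : E, (a g : ℕ) • (g : G)) + ∑ g : E, (b g : ℕ) • (g : G) := by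
    have := congrArg (fun y : H => (y : G)) hy
    simpa [φ] using this
  let u : G → ℤ := fun g => if h : g ∈ E then ((b ⟨g, h⟩ : ℕ) : ℤ) - (a ⟨g, h⟩ : ℕ) else 0
  have hu : ∑ g, u g • g = (p : ℕ) • (y : G) := by
    rw [hy']
    have : ∑ g, u g • g = ∑ g ∈ E, u g • g := by
      symm
      refine Finset.sum_subset (Finset.subset_univ _) ?_
      intro g _ hg; simp [u, hg]
    rw [this, ← Finset.sum_coe_sort E]
    rw [neg_add_eq_sub, ← Finset.sum_sub_distrib]
    refine Finset.sum_congr rfl ?_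
    intro g _
    simp [u, sub_smul]
  obtain ⟨g, hg⟩ := Function.ne_iff.1 hab
  refine ⟨fun g => u g - p * z g, ?_, ?_, g, g.2, ?_⟩
  · intro g hg
    by_contra hgE
    have : z g = 0 := by by_contra h; exact hgE (hz g h)
    simp [u, hgE, this] at hg
  · simp only [sub_smul, mul_smul, Finset.sum_sub_distrib]
    rw [← Finset.smul_sum, ← hyz, hu]; simp
  · intro hd
    have h2 : (p : ℤ) ∣ u g := by
      have := dvd_add hd (Dvd.intro (z g) rfl : (p : ℤ) ∣ p * z g)
      simpa using this
    have h3 : u g = ((b g : ℕ) : ℤ) - (a g : ℕ) := by simp [u]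
    rw [h3] at h2
    have ha := (a g).2
    have hb := (b g).2
    have h4 : ((b g : ℕ) : ℤ) - (a g : ℕ) = 0 := by
      apply Int.eq_zero_of_abs_lt_dvd h2
      rw [abs_lt]; constructor <;> omega
    apply hg
    apply Fin.ext; omega

/-- Relations supported on a proper subset. -/
def PR (S : Set G) : Set (G → ℤ) :=
  {z | ∑ g, z g • g = 0 ∧ ∃ h ∈ S, ∀ g, z g ≠ 0 → g ∈ S ∧ g ≠ h}

/-- The count vector. -/
noncomputable def cv (B : Multiset G) : G → ℤ := fun g => (B.count g : ℤ)

lemma cv_sum (B : Multiset G) : ∑ g, cv B g • g = B.sum := by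
  rw [sum_eq_count]; simp [cv]

lemma cv_mem {s : ℕ} (htor : ∀ p, 1 < p → Nat.card {x : G // p • x = 0} ≤ p ^ s) {S : Set G}
    (hS : s + 2 ≤ S.toFinset.card) {B : Multiset G} (hB : B.sum = 0) (hO : Over S B) :
    cv B ∈ AddSubgroup.closure (PR S) := by
  set T := AddSubgroup.closure (PR S) with hT
  let J : AddSubgroup ℤ := T.comap (smulAddHom ℤ (G → ℤ) |>.flip (cv B))
  have hJ : ∀ m : ℤ, m ∈ J ↔ m • cv B ∈ T := fun m => Iff.rfl
  suffices h : (1 : ℤ) ∈ J by simpa [hJ] using h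
  obtain ⟨a, ha⟩ := Int.subgroup_cyclic J
  have haJ : ∀ m : ℤ, m ∈ J ↔ a ∣ m := by
    intro m
    rw [ha, AddSubgroup.mem_closure_singleton]
    constructor
    · rintro ⟨k, rfl⟩; exact ⟨k, by simp [mul_comm]⟩
    · rintro ⟨k, rfl⟩; exact ⟨k, by simp [mul_comm]⟩
  rw [haJ]
  by_contra hne
  have hne' : a.natAbs ≠ 1 := by
    intro h
    exact hne (Int.isUnit_iff_natAbs_eq.2 h).dvd
  obtain ⟨p, hp, hpa⟩ := Nat.exists_prime_and_dvd hne'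
  obtain ⟨E, hES, hE⟩ := Finset.exists_subset_card_eq (s := S.toFinset) (n := s + 1) (by omega)
  obtain ⟨h, hhS, hhE⟩ : ∃ h ∈ S.toFinset, h ∉ E := by
    by_contra hcon
    push Not at hcon
    have := Finset.card_le_card (show S.toFinset ⊆ E from hcon)
    omega
  have hES' : ∀ g ∈ E, g ∈ S := fun g hg => Set.mem_toFinset.1 (hES hg)
  obtain ⟨x, hx, hxs, g, hg, hpg⟩ := dep hp.one_lt (htor p hp.one_lt) hE
  have hxT : x ∈ T := AddSubgroup.subset_closure ⟨hxs, h, Set.mem_toFinset.1 hhS, fun g' hg' => 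
    ⟨hES' g' (hx g' hg'), fun e => hhE (e ▸ hx g' hg')⟩⟩
  have hy : x g • cv B - cv B g • x ∈ T := by
    refine AddSubgroup.subset_closure ⟨?_, g, hES' g hg, ?_⟩
    · simp only [Pi.sub_apply, Pi.smul_apply, smul_assoc, sub_smul, Finset.sum_sub_distrib]
      rw [← Finset.smul_sum, ← Finset.smul_sum, hxs, cv_sum, hB]; simp
    · intro g' hg'
      constructor
      · by_contra hS'
        apply hg'
        have h1 : x g' = 0 := by by_contra h; exact hS' (hES' _ (hx g' h))
        have h2 : cv B g' = 0 := by
          simp only [cv, Nat.cast_eq_zero, Multiset.count_eq_zero]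
          intro h; exact hS' (hO _ h)
        simp [h1, h2]
      · rintro rfl
        apply hg'; simp [mul_comm]
  have : x g • cv B ∈ T := by
    have := T.add_mem hy (T.zsmul_mem hxT (cv B g))
    simpa using this
  rw [← hJ, haJ] at this
  exact hpg ((Int.natCast_dvd.2 hpa).trans this)

/-- Products of atoms with cross number one. -/
def Good (n : ℕ) (B : Multiset G) : Prop :=
  ∃ F, Fctn F ∧ F.sum = B ∧ ∀ U ∈ F, wt n U = n

lemma Good.add {n : ℕ} {A B : Multiset G} (hA : Good n A) (hB : Good n B) : Good n (A + B) := by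
  obtain ⟨F, hF, rfl, h⟩ := hA
  obtain ⟨F', hF', rfl, h'⟩ := hB
  refine ⟨F + F', hF.add hF', by simp, ?_⟩
  intro U hU
  rcases Multiset.mem_add.1 hU with h1 | h1
  · exact h U h1
  · exact h' U h1

lemma Good.zero {n : ℕ} : Good n (0 : Multiset G) := ⟨0, Fctn.zero, by simp, by simp⟩

lemma Good.nsmul {n : ℕ} {A : Multiset G} (hA : Good n A) (k : ℕ) : Good n (k • A) := by
  induction k with
  | zero => simpa using Good.zero
  | succ k ih => rw [succ_nsmul]; exact ih.add hA

lemma Good.hasLen {n : ℕ} {A : Multiset G} (hA : Good n A) :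
    ∃ c, HasLen A c ∧ wt n A = n * c := by
  obtain ⟨F, hF, rfl, h⟩ := hA
  exact ⟨_, ⟨F, hF, rfl, rfl⟩, sum_map_const_of h⟩

lemma good_of_hf {n : ℕ} (hexp : ∀ g : G, n • g = 0) {S : Set G} (hS : ¬ NonHF S)
    {B : Multiset G} (hO : Over S B) (hs : B.sum = 0) : Good n B := by
  obtain ⟨F, hF, rfl⟩ := exists_fact hs
  exact ⟨F, hF, rfl, fun U hU => wt_eq_of_hf hexp hS (hF U hU) (hO.mem_fact hU)⟩

lemma split_of_mem {n : ℕ} (hn : 0 < n) (hexp : ∀ g : G, n • g = 0) {S : Set G}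
    (hmin : ∀ h ∈ S, ¬ NonHF (S \ {h})) {z : G → ℤ} (hz : z ∈ AddSubgroup.closure (PR S)) :
    ∃ P Q : Multiset G, Good n P ∧ Good n Q ∧ Over S P ∧ Over S Q ∧ z = cv P - cv Q := by
  induction hz using AddSubgroup.closure_induction with
  | mem z hz =>
    obtain ⟨hs, h, hhS, hsupp⟩ := hz
    have hnn : ∀ g, 0 ≤ z g + n * |z g| := by
      intro g
      have h1 := neg_abs_le (z g)
      have h2 : 1 * |z g| ≤ n * |z g| := by
        apply mul_le_mul_of_nonneg_right _ (abs_nonneg _)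
        exact_mod_cast hn
      linarith
    have e1 : ∀ g, (((z g + n * |z g|).toNat : ℕ) : ℤ) = z g + n * |z g| := 
      fun g => Int.toNat_of_nonneg (hnn g)
    have e2 : ∀ g : G, (n * |z g|) • g = 0 := by
      intro g
      rw [mul_comm, mul_smul]; simp [hexp]
    have k1 : ∀ f : G → ℕ, (∀ g, f g ≠ 0 → z g ≠ 0) → Over (S \ {h}) (mkM f) := by
      intro f hf g hg
      have := hsupp g (hf g (mem_mkM.1 hg))
      exact ⟨this.1, this.2⟩
    have hO1 : Over (S \ {h}) (mkM (fun g => (z g + n * |z g|).toNat)) := by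
      apply k1
      intro g hg h0
      simp [h0] at hg
    have hO2 : Over (S \ {h}) (mkM (fun g => n * (z g).natAbs)) := by
      apply k1
      intro g hg h0
      simp [h0] at hg
    refine ⟨_, _, good_of_hf hexp (hmin h hhS) hO1 ?_, good_of_hf hexp (hmin h hhS) hO2 ?_,
      hO1.mono Set.diff_subset, hO2.mono Set.diff_subset, ?_⟩
    · rw [sum_mkM, ← hs]
      refine Finset.sum_congr rfl ?_
      intro g _
      rw [← natCast_zsmul, e1, add_smul, e2, add_zero]
    · rw [sum_mkM]
      refine Finset.sum_eq_zero ?_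
      intro g _
      rw [mul_comm, mul_smul, hexp, smul_zero]
    · funext g
      simp only [cv, Pi.sub_apply, count_mkM, e1]
      push_cast
      ring
  | zero => exact ⟨0, 0, Good.zero, Good.zero, by intro g hg; simp at hg,
      by intro g hg; simp at hg, by simp⟩
  | add x y _ _ hx hy =>
    obtain ⟨P, Q, h1, h2, h3, h4, rfl⟩ := hx
    obtain ⟨P', Q', h1', h2', h3', h4', rfl⟩ := hy
    refine ⟨P + P', Q + Q', h1.add h1', h2.add h2', h3.add h3', h4.add h4', ?_⟩
    funext g; simp [cv]; ring
  | neg x _ hx =>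
    obtain ⟨P, Q, h1, h2, h3, h4, rfl⟩ := hx
    exact ⟨Q, P, h2, h1, h4, h3, by simp⟩

end LCN

open scoped Classical

section LCN2

variable {G : Type*} [AddCommGroup G] [Fintype G]

lemma count_fsum (F : Multiset (Multiset G)) (g : G) :
    F.sum.count g = (F.map (fun U => U.count g)).sum := by
  induction F using Multiset.induction_on with
  | empty => simp
  | cons U F ih => simp [ih]

lemma card_mul_le_count {t : ℕ} {F : Multiset (Multiset G)} {g : G}
    (h : ∀ U ∈ F, t ≤ U.count g) : Multiset.card F * t ≤ F.sum.count g := by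
  rw [count_fsum]
  have := Multiset.card_nsmul_le_sum (s := F.map (fun U => U.count g)) (a := t) (by
    intro x hx; obtain ⟨U, hU, rfl⟩ := Multiset.mem_map.1 hx; exact h U hU)
  simpa using this

lemma nsmul_eq_pw {n : ℕ} (hexp : ∀ g : G, n • g = 0) {S : Set G} {Q : Multiset G}
    (hQ : Over S Q) : ∃ H : Multiset G, Over S H ∧ n • Q = (H.map pw).sum := by
  induction Q using Multiset.induction_on with
  | empty => exact ⟨0, hQ, by simp⟩
  | cons g Q ih =>
    obtain ⟨H, h1, h2⟩ := ih (fun x hx => hQ x (Multiset.mem_cons_of_mem hx))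
    refine ⟨Multiset.replicate (n / addOrderOf g) g + H, ?_, ?_⟩
    · refine Over.add ?_ h1
      intro x hx
      rw [Multiset.eq_of_mem_replicate hx]; exact hQ g (by simp)
    · rw [← Multiset.singleton_add, nsmul_add, h2, Multiset.map_add, Multiset.sum_add,
        Multiset.map_replicate, Multiset.sum_replicate]
      congr 1
      rw [pw, Multiset.nsmul_replicate, Nat.div_mul_cancel (ord_dvd hexp g),
        Multiset.nsmul_singleton]

lemma exists_step {n : ℕ} {S : Set G} (H : Multiset G) (hH : Over S H) :
    ∀ B : Multiset G, Over S B → B.sum = 0 → ¬ Good n B → Good n (B + (H.map pw).sum) →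
    ∃ (B' : Multiset G) (h : G), Over S B' ∧ B'.sum = 0 ∧ ¬ Good n B' ∧ h ∈ S ∧
      Good n (B' + pw h) := by
  induction H using Multiset.induction_on with
  | empty => intro B _ _ h1 h2; exact absurd (by simpa using h2) h1
  | cons g H ih =>
    intro B hO hs hb hg
    by_cases h : Good n (B + pw g)
    · exact ⟨B, g, hO, hs, hb, hH g (by simp), h⟩
    · refine ih (fun x hx => hH x (Multiset.mem_cons_of_mem hx)) (B + pw g)
        (hO.add (pw_over (hH g (by simp)))) (by simp [hs, pw_sum]) h ?_
      simpa [add_assoc] using hg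

lemma lcn_big {n d s : ℕ} (hn : 0 < n) (hexp : ∀ g : G, n • g = 0)
    (htor : ∀ p, 1 < p → Nat.card {x : G // p • x = 0} ≤ p ^ s) {S : Set G} (hmod : Modd d S)
    (hmin : ∀ h ∈ S, ¬ NonHF (S \ {h})) (hS : s + 2 ≤ S.toFinset.card)
    (hlcn : ∀ U : Multiset G, Atom U → Over S U → n ≤ wt n U) {U : Multiset G} (hU : Atom U)
    (hO : Over S U) (hw : n < wt n U) : 2 * d + 3 ≤ n := by
  have key : ∀ B : Multiset G, B.sum = 0 → Over S B → ∃ P Q, Good n P ∧ Good n Q ∧ Over S P ∧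
      Over S Q ∧ B + Q = P := by
    intro B hB hBO
    obtain ⟨P, Q, h1, h2, h3, h4, h5⟩ := split_of_mem hn hexp hmin (cv_mem htor hS hB hBO)
    refine ⟨P, Q, h1, h2, h3, h4, ?_⟩
    ext g
    have := congrFun h5 g
    simp only [cv, Pi.sub_apply] at this
    rw [Multiset.count_add]; omega
  have badwt : ∀ V : Multiset G, Atom V → Over S V → wt n V ≠ n → (d + 1) * n ≤ wt n V := by
    intro V hV hVO hne
    obtain ⟨P, Q, h1, h2, h3, h4, h5⟩ := key V hV.sum hVO
    obtain ⟨p, hp, hpw⟩ := h1.hasLen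
    obtain ⟨q, hq, hqw⟩ := h2.hasLen
    have hd := hmod P p (1 + q) h3 hp (h5 ▸ (HasLen.atom hV).add hq)
    have e : wt n V + n * q = n * p := by rw [← hqw, ← hpw, ← h5, wt_add]
    have hl := hlcn V hV hVO
    have hlt : n < wt n V := lt_of_le_of_ne hl (Ne.symm hne)
    have h6 : n * (1 + q) < n * p := by rw [mul_add, mul_one, ← e]; omega
    have h7 : 1 + q < p := Nat.lt_of_mul_lt_mul_left h6
    have h8 : (d : ℤ) ≤ (p : ℤ) - (1 + q : ℕ) := Int.le_of_dvd (by omega) hd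
    have h9 : d + 1 + q ≤ p := by push_cast at h8; omega
    have := Nat.mul_le_mul_left n h9
    nlinarith
  have badwt' : ∀ B : Multiset G, B.sum = 0 → Over S B → ¬ Good n B → (d + 1) * n ≤ wt n B := by
    intro B hs hBO hb
    obtain ⟨F, hF, rfl⟩ := exists_fact hs
    by_contra hcon
    apply hb
    refine ⟨F, hF, rfl, fun V hV => ?_⟩
    by_contra hne
    exact hcon ((badwt V (hF V hV) (hBO.mem_fact hV) hne).trans
      (wt_mono n (Multiset.le_sum_of_mem hV)))
  have hUbad : ¬ Good n U := by
    rintro ⟨F, hF, hFs, hFw⟩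
    have h0 : F ≠ 0 := by rintro rfl; exact hU.ne_zero (by simpa using hFs.symm)
    obtain ⟨V, hV⟩ := Multiset.exists_mem_of_ne_zero h0
    have : V = U := hU.eq_of_le (hFs ▸ Multiset.le_sum_of_mem hV) (hF V hV).ne_zero (hF V hV).sum
    have := hFw V hV
    subst V; omega
  have hex : ∃ k, ∃ (B : Multiset G) (h : G), Over S B ∧ B.sum = 0 ∧ ¬ Good n B ∧ h ∈ S ∧
      Good n (B + pw h) ∧ Multiset.card B = k := by
    obtain ⟨P, Q, h1, h2, h3, h4, h5⟩ := key U hU.sum hO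
    obtain ⟨H, hH, hHe⟩ := nsmul_eq_pw hexp h4
    have : Good n (U + (H.map pw).sum) := by
      rw [← hHe]
      have : U + n • Q = P + (n - 1) • Q := by
        rw [← h5, add_assoc, ← succ_nsmul', Nat.sub_add_cancel hn]
      rw [this]; exact h1.add (h2.nsmul _)
    obtain ⟨B, h, a1, a2, a3, a4, a5⟩ := exists_step H hH U hO hU.sum hUbad this
    exact ⟨_, B, h, a1, a2, a3, a4, a5, rfl⟩
  obtain ⟨B, h, hBO, hBs, hBb, hhS, hgood, hcard⟩ := Nat.find_spec hex
  have hminB := fun m hm => Nat.find_min hex (m := m) hm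
  rw [← hcard] at hminB
  obtain ⟨F, hF, hFs, hFw⟩ := hgood
  have hW : ∀ W ∈ F, B.count h + 1 ≤ W.count h := by
    intro W hWF
    by_contra hcon
    have hle : W ≤ B := by
      rw [Multiset.le_iff_count]
      intro g
      by_cases hg : g = h
      · subst g; omega
      · have h1 : W ≤ B + pw h := hFs ▸ Multiset.le_sum_of_mem hWF
        have := Multiset.le_iff_count.1 h1 g
        rw [Multiset.count_add, pw, Multiset.count_replicate, if_neg (Ne.symm hg)] at this
        simpa using this
    have hlt : Multiset.card (B - W) < Multiset.card B := by
      have h1 := Multiset.card_pos.2 (hF W hWF).ne_zero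
      have h2 := Multiset.card_le_card hle
      rw [Multiset.card_sub hle]; omega
    refine hminB _ hlt ⟨B - W, h, hBO.le tsub_le_self, sum_sub_zero hle hBs (hF W hWF).sum, ?_, hhS,
      ?_, rfl⟩
    · intro hg
      apply hBb
      have : Good n W := ⟨{W}, by intro V hV; rw [Multiset.mem_singleton.1 hV]; exact hF W hWF,
        by simp, by intro V hV; rw [Multiset.mem_singleton.1 hV]; exact hFw W hWF⟩
      have h2 := hg.add this
      rwa [tsub_add_cancel_of_le hle] at h2
    · obtain ⟨F', rfl⟩ := Multiset.exists_cons_of_mem hWF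
      refine ⟨F', hF.mono (Multiset.le_cons_self _ _), ?_, fun V hV =>
        hFw V (Multiset.mem_cons_of_mem hV)⟩
      rw [Multiset.sum_cons] at hFs
      have : W + F'.sum = W + (B - W + pw h) := by
        rw [hFs, ← add_assoc, add_tsub_cancel_of_le hle]
      exact add_left_cancel this
  have hb1 : 1 ≤ B.count h := by
    by_contra hcon
    apply hBb
    refine good_of_hf hexp (hmin h hhS) ?_ hBs
    intro g hg
    refine ⟨hBO g hg, ?_⟩
    rintro rfl
    exact hcon (Multiset.one_le_count_iff_mem.2 hg)
  have h1 := card_mul_le_count hW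
  rw [hFs, Multiset.count_add, pw, Multiset.count_replicate_self] at h1
  have h2 := sum_map_const_of hFw
  rw [hFs, wt_add, wt_pw hexp] at h2
  have h3 := badwt' B hBs hBO hBb
  have h4 : n * (d + 2) ≤ n * Multiset.card F := by rw [← h2]; nlinarith
  have h5 : d + 2 ≤ Multiset.card F := Nat.le_of_mul_le_mul_left h4 hn
  have h6 := Nat.le_of_dvd hn (ord_dvd hexp h)
  have h7 := Nat.mul_le_mul_right (B.count h + 1) h5
  nlinarith

theorem lcn_bound {n d s : ℕ} (hn : 0 < n) (hexp : ∀ g : G, n • g = 0)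
    (htor : ∀ p, 1 < p → Nat.card {x : G // p • x = 0} ≤ p ^ s) {S : Set G} (hmod : Modd d S)
    (hS : NonHF S) (hlcn : ∀ U : Multiset G, Atom U → Over S U → n ≤ wt n U) :
    d + 1 ≤ s ∨ 2 * d + 3 ≤ n := by
  -- minimal subset
  obtain ⟨T, hTS, hT⟩ := (Set.toFinite {T : Set G | NonHF T}).exists_le_minimal hS
  have hTn : NonHF T := hT.1
  have hmin : ∀ h ∈ T, ¬ NonHF (T \ {h}) := by
    intro h hh hc
    have := hT.2 (show T \ {h} ∈ {T : Set G | NonHF T} from hc) Set.diff_subset hh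
    exact this.2 rfl
  have hmod' := hmod.mono hTS
  have hlcn' : ∀ U : Multiset G, Atom U → Over T U → n ≤ wt n U :=
    fun U h1 h2 => hlcn U h1 (h2.mono hTS)
  obtain ⟨U, hU, hUO, hw⟩ : ∃ U, Atom U ∧ Over T U ∧ wt n U ≠ n := by
    by_contra hcon
    push Not at hcon
    exact hf_of_wt_eq hn hcon hTn
  have hw' : n < wt n U := lt_of_le_of_ne (hlcn' U hU hUO) (Ne.symm hw)
  by_cases hc : s + 2 ≤ T.toFinset.card
  · right; exact lcn_big hn hexp htor hmod' hmin hc hlcn' hU hUO hw'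
  · left
    have h1 := small_case hn hexp hmod' hlcn' hU hUO hw'
    have h2 : U.toFinset.card ≤ T.toFinset.card := Finset.card_le_card (by
      intro g hg; exact Set.mem_toFinset.2 (hUO g (Multiset.mem_toFinset.1 hg)))
    omega

end LCN2

open scoped Classical

section NonLCN

variable {G : Type*} [AddCommGroup G] [Fintype G]

lemma wt_ge_two {n : ℕ} (hn : 0 < n) (hexp : ∀ g : G, n • g = 0) {A : Multiset G} (hA : Atom A)
    (hlow : wt n A < n) : 2 ≤ wt n A := by
  have h1 := card_le_wt hn hexp A
  have h2 := Multiset.card_pos.2 hA.ne_zero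
  by_contra hcon
  have h3 : Multiset.card A = 1 := by omega
  obtain ⟨g, rfl⟩ := Multiset.card_eq_one.1 h3
  have h4 : g = 0 := by simpa using hA.sum
  subst h4
  simp [wt] at hlow

lemma dvd_of_atom {n d : ℕ} (hexp : ∀ g : G, n • g = 0) {S : Set G} (hmod : Modd d S)
    {A : Multiset G} (hA : Atom A) (hO : Over S A) : (d : ℤ) ∣ (n : ℤ) - wt n A :=
  hmod (n • A) n (wt n A) (hO.nsmul n) (hasLen_nsmul_atom hA n) (hasLen_nsmul_wt hexp A)

/-- The general upper bound. -/
theorem modd_bound {n d s : ℕ} (hn : 0 < n) (hexp : ∀ g : G, n • g = 0)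
    (htor : ∀ p, 1 < p → Nat.card {x : G // p • x = 0} ≤ p ^ s) {S : Set G} (hmod : Modd d S)
    (hS : NonHF S) : d + 2 ≤ n ∨ d + 1 ≤ s := by
  by_cases h : ∀ U : Multiset G, Atom U → Over S U → n ≤ wt n U
  · rcases lcn_bound hn hexp htor hmod hS h with h | h
    · right; exact h
    · left; omega
  · push Not at h
    obtain ⟨A, hA, hO, hlow⟩ := h
    have h1 := wt_ge_two hn hexp hA hlow
    have h2 := Int.le_of_dvd (by omega) (dvd_of_atom hexp hmod hA hO)
    left; omega

/-- Standing assumptions of the analysis. -/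
structure Setup (n d s : ℕ) (S : Set G) : Prop where
  hn : 0 < n
  hexp : ∀ g : G, n • g = 0
  htor : ∀ p, 1 < p → Nat.card {x : G // p • x = 0} ≤ p ^ s
  hmod : Modd d S
  hsd : s ≤ d
  hnd : n < 2 * d + 2

variable {n d s : ℕ} {S : Set G}

lemma Setup.exists_low (h : Setup n d s S) {T : Set G} (hT : T ⊆ S) (hTn : NonHF T) :
    ∃ A, Atom A ∧ Over T A ∧ wt n A < n := by
  by_contra hcon
  push Not at hcon
  have := lcn_bound h.hn h.hexp h.htor (h.hmod.mono hT) hTn hcon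
  have := h.hsd
  have := h.hnd
  omega

lemma Setup.low_wt (h : Setup n d s S) {A : Multiset G} (hA : Atom A) (hO : Over S A)
    (hlow : wt n A < n) : wt n A + d = n := by
  have h1 := wt_ge_two h.hn h.hexp hA hlow
  obtain ⟨k, hk⟩ := dvd_of_atom h.hexp h.hmod hA hO
  have := h.hnd
  have hk1 : 0 < k := by
    by_contra hc
    have : (d : ℤ) * k ≤ 0 := mul_nonpos_of_nonneg_of_nonpos (by omega) (by omega)
    omega
  have hk2 : k < 2 := by
    by_contra hc
    have : (d : ℤ) * 2 ≤ d * k := mul_le_mul_of_nonneg_left (by omega) (by omega)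
    omega
  have : k = 1 := by omega
  subst this
  omega

lemma Setup.le_wt (h : Setup n d s S) {A : Multiset G} (hA : Atom A) (hO : Over S A) :
    n - d ≤ wt n A := by
  by_cases hl : wt n A < n
  · have := h.low_wt hA hO hl; omega
  · omega

lemma Setup.low_struct (h : Setup n d s S) {A : Multiset G} (hA : Atom A) (hO : Over S A)
    (hlow : wt n A < n) {g : G} (hg : g ∈ A) : A.count g = 1 ∧ addOrderOf g = n := by
  have hw := h.low_wt hA hO hlow
  have hw2 := wt_ge_two h.hn h.hexp hA hlow
  have hne : A ≠ pw g := by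
    intro e; rw [e, wt_pw h.hexp] at hlow; exact lt_irrefl _ hlow
  have ha0 : 0 < A.count g := Multiset.count_pos.2 hg
  have hao := count_lt_of_atom hA hne
  have hoN := Nat.le_of_dvd h.hn (ord_dvd h.hexp g)
  obtain ⟨j, hj1, hj2⟩ : ∃ j, addOrderOf g ≤ j * A.count g ∧ j * A.count g < addOrderOf g + A.count g := by
    refine ⟨(addOrderOf g + A.count g - 1) / A.count g, ?_, ?_⟩
    · have h1 := Nat.div_add_mod (addOrderOf g + A.count g - 1) (A.count g)
      have h2 := Nat.mod_lt (addOrderOf g + A.count g - 1) ha0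
      rw [mul_comm] at h1; omega
    · have := Nat.div_mul_le_self (addOrderOf g + A.count g - 1) (A.count g)
      omega
  have hle : pw g ≤ j • A := by rw [pw_le_iff, Multiset.count_nsmul]; exact hj1
  obtain ⟨F, hF, hFs⟩ := exists_fact (sum_sub_zero hle (by simp [Multiset.sum_nsmul, hA.sum]) (pw_sum g))
  have hOj : Over S (j • A) := hO.nsmul j
  have hFO : Over S F.sum := by rw [hFs]; exact hOj.le tsub_le_self
  have heq : pw g + F.sum = j • A := by rw [hFs]; exact add_tsub_cancel_of_le hle
  have h1 := card_mul_le_wt (n := n) (t := wt n A) (F := F) (by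
    intro U hU
    have := h.le_wt (hF U hU) (hFO.mem_fact hU)
    omega)
  have h2 : n + wt n F.sum = j * wt n A := by
    rw [← wt_nsmul, ← heq, wt_add, wt_pw h.hexp]
  have hlen : HasLen (j • A) (1 + Multiset.card F) := by
    rw [← heq]; exact (HasLen.atom (pw_atom g)).add ⟨F, hF, rfl, rfl⟩
  have hd := h.hmod _ _ _ hOj (hasLen_nsmul_atom hA j) hlen
  have hc1 : 1 ≤ Multiset.card F := by
    by_contra hcon
    have : F = 0 := by rw [← Multiset.card_eq_zero]; omega
    subst this
    have hj0 : j ≠ 0 := by rintro rfl; have := ord_pos g; omega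
    have hle' : A ≤ pw g := by
      have e : pw g = j • A := by simpa using heq
      rw [e]
      obtain ⟨k, rfl⟩ := Nat.exists_eq_succ_of_ne_zero hj0
      rw [Nat.succ_eq_add_one, succ_nsmul]; exact Multiset.le_add_left _ _
    exact hne ((pw_atom g).eq_of_le hle' hA.ne_zero hA.sum)
  have hlt : Multiset.card F + 1 < j := by
    have : (Multiset.card F + 1) * wt n A < j * wt n A := by
      rw [← h2]; nlinarith
    exact Nat.lt_of_mul_lt_mul_right this
  have h3 := Int.le_of_dvd (by push_cast; omega) hd
  have h4 : d + 2 ≤ j := by push_cast at h3; omega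
  have hnd := h.hnd
  have ha1 : A.count g = 1 := by
    by_contra hc
    have : 2 ≤ A.count g := by omega
    obtain ⟨m, rfl⟩ := Nat.exists_eq_add_of_le h4
    nlinarith
  refine ⟨ha1, ?_⟩
  rw [ha1] at hj1 hj2
  obtain ⟨q, hq⟩ := ord_dvd h.hexp g
  have hq0 : q ≠ 0 := by rintro rfl; have := h.hn; omega
  have hq2 : q < 2 := by
    by_contra hc
    have : addOrderOf g * 2 ≤ addOrderOf g * q := Nat.mul_le_mul_left _ (by omega)
    omega
  have : q = 1 := by omega
  subst this; omega

lemma Setup.low_nodup (h : Setup n d s S) {A : Multiset G} (hA : Atom A) (hO : Over S A)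
    (hlow : wt n A < n) : A.Nodup := by
  rw [Multiset.nodup_iff_count_le_one]
  intro g
  by_cases hg : g ∈ A
  · exact (h.low_struct hA hO hlow hg).1.le
  · rw [Multiset.count_eq_zero_of_notMem hg]; omega

lemma Setup.low_card (h : Setup n d s S) {A : Multiset G} (hA : Atom A) (hO : Over S A)
    (hlow : wt n A < n) : Multiset.card A + d = n := by
  have h1 : wt n A = Multiset.card A := by
    have : ∀ g ∈ A, n / addOrderOf g = 1 := by
      intro g hg
      rw [(h.low_struct hA hO hlow hg).2]; exact Nat.div_self h.hn
    rw [wt, Multiset.map_congr rfl this]; simp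
  rw [← h1]; exact h.low_wt hA hO hlow

lemma Setup.wt_le (h : Setup n d s S) {U : Multiset G} (hU : Atom U) (hO : Over S U) :
    wt n U ≤ n := by
  by_contra hcon
  have hsub : suppSet U ⊆ S := fun g hg => hO g hg
  have hUO : Over (suppSet U) U := fun g hg => hg
  have hN : NonHF (suppSet U) := ⟨n • U, wt n U, n, hUO.nsmul n, hasLen_nsmul_wt h.hexp U,
    hasLen_nsmul_atom hU n, by omega⟩
  obtain ⟨A, hA, hAO, hlow⟩ := h.exists_low hsub hN
  have hle : A ≤ U := (Multiset.le_iff_subset (h.low_nodup hA (hAO.mono hsub) hlow)).2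
    (fun g hg => hAO g hg)
  have := hU.eq_of_le hle hA.ne_zero hA.sum
  subst this; omega

lemma Setup.indep (h : Setup n d s S) {A : Multiset G} {g0 : G} (hA : Atom (g0 ::ₘ A))
    (hO : Over S (g0 ::ₘ A)) (hlow : wt n (g0 ::ₘ A) < n) {B : Multiset G}
    (hB : Over (suppSet A) B) (hs : B.sum = 0) (hlt : ∀ g, B.count g < n) : B = 0 := by
  by_contra hB0
  obtain ⟨g, hg⟩ := Multiset.exists_mem_of_ne_zero hB0
  have hgA : g ∈ g0 ::ₘ A := Multiset.mem_cons_of_mem (hB g hg)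
  have hnd := h.low_nodup hA hO hlow
  have hA'sub : suppSet A ⊆ S := fun x hx => hO x (Multiset.mem_cons_of_mem hx)
  have nolow : ∀ T : Set G, T ⊆ suppSet (g0 ::ₘ A) → (∃ x ∈ g0 ::ₘ A, x ∉ T) → ¬ NonHF T := by
    rintro T hT ⟨x, hx, hxT⟩ hN
    have hTS : T ⊆ S := fun y hy => hO y (hT hy)
    obtain ⟨V, hV, hVO, hVl⟩ := h.exists_low hTS hN
    have hle : V ≤ g0 ::ₘ A := (Multiset.le_iff_subset (h.low_nodup hV (hVO.mono hTS) hVl)).2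
      (fun g hg => hT (hVO g hg))
    have := hA.eq_of_le hle hV.ne_zero hV.sum
    subst this
    exact hxT (hVO x hx)
  have hf1 : ¬ NonHF (suppSet A) := nolow _ (fun x hx => Multiset.mem_cons_of_mem hx)
    ⟨g0, by simp, (Multiset.nodup_cons.1 hnd).1⟩
  have hf2 : ¬ NonHF (suppSet (g0 ::ₘ A) \ {g}) := nolow _ Set.diff_subset
    ⟨g, hgA, fun hh => hh.2 rfl⟩
  obtain ⟨β, hβ, hβw⟩ := (good_of_hf h.hexp hf1 hB hs).hasLen
  set C := B + (n - B.count g) • (g0 ::ₘ A) with hC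
  have hCO : Over (suppSet (g0 ::ₘ A)) C := 
    (hB.mono (fun x hx => Multiset.mem_cons_of_mem hx)).add (Over.nsmul (fun x hx => hx) _)
  have hcg : C.count g = n := by
    rw [hC, Multiset.count_add, Multiset.count_nsmul, (h.low_struct hA hO hlow hgA).1]
    have := hlt g; omega
  have hog := (h.low_struct hA hO hlow hgA).2
  have hle : pw g ≤ C := by rw [pw_le_iff, hcg, hog]
  have hYs := sum_sub_zero hle (by
    rw [hC, Multiset.sum_add, hs, Multiset.sum_nsmul, hA.sum]; simp) (pw_sum g)
  have hYO : Over (suppSet (g0 ::ₘ A) \ {g}) (C - pw g) := by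
    intro x hx
    refine ⟨hCO.le tsub_le_self x hx, ?_⟩
    rintro rfl
    rw [← Multiset.count_ne_zero, Multiset.count_sub, hcg, pw, Multiset.count_replicate_self,
      hog] at hx
    omega
  obtain ⟨y, hy, hyw⟩ := (good_of_hf h.hexp hf2 hYO hYs).hasLen
  have hCe : pw g + (C - pw g) = C := add_tsub_cancel_of_le hle
  have hl1 : HasLen C (β + (n - B.count g)) := hβ.add (hasLen_nsmul_atom hA _)
  have hl2 : HasLen C (1 + y) := by
    rw [← hCe]; exact (HasLen.atom (pw_atom g)).add hy
  have hCS : Over S C := hCO.mono (fun x hx => hO x hx)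
  have hd := h.hmod _ _ _ hCS hl1 hl2
  have hw1 : wt n C = n * β + (n - B.count g) * wt n (g0 ::ₘ A) := by
    rw [hC, wt_add, wt_nsmul, hβw]
  have hw2 : wt n C = n + n * y := by
    rw [← hCe, wt_add, wt_pw h.hexp, hyw]
  have hwA := h.low_wt hA hO hlow
  have hd0 : 0 < d := by omega
  have hb := hlt g
  have hb0 : 0 < B.count g := Multiset.count_pos.2 hg
  obtain ⟨c, hc⟩ : ∃ c, c = n - B.count g := ⟨_, rfl⟩
  rw [← hc] at hw1 hd
  have hc0 : 0 < c := by omega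
  have hcn : c < n := by omega
  have e : (n : ℤ) * ((β + c : ℕ) - (1 + y : ℕ)) = c * d := by
    have e1 : (n : ℤ) * β + c * wt n (g0 ::ₘ A) = n + n * y := by exact_mod_cast hw1.symm.trans hw2
    have e2 : (n : ℤ) = wt n (g0 ::ₘ A) + d := by exact_mod_cast hwA.symm
    push_cast
    linear_combination e1 + c * e2
  set D : ℤ := (β + c : ℕ) - (1 + y : ℕ) with hD
  have hDpos : 0 < D := by
    by_contra hcon
    have : (n : ℤ) * D ≤ 0 := mul_nonpos_of_nonneg_of_nonpos (by omega) (by omega)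
    have : (0 : ℤ) < c * d := by positivity
    omega
  have hDd := Int.le_of_dvd hDpos hd
  have : (n : ℤ) * d ≤ n * D := mul_le_mul_of_nonneg_left hDd (by omega)
  have : (c : ℤ) * d < n * d := mul_lt_mul_of_pos_right (by omega) (by omega)
  omega

/-- A hom from a power of a cyclic group. -/
noncomputable def powHom {m : ℕ} (hexp : ∀ g : G, n • g = 0) (f : Fin m → G) :
    (Fin m → ZMod n) →+ G :=
  ∑ i, (ZMod.lift n ⟨(zmultiplesHom G (f i)), by simp [hexp]⟩).comp
    (Pi.evalAddMonoidHom (fun _ : Fin m => ZMod n) i)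

lemma powHom_apply {m : ℕ} [NeZero n] (hexp : ∀ g : G, n • g = 0) (f : Fin m → G)
    (x : Fin m → ZMod n) : powHom hexp f x = ∑ i, (x i).val • f i := by
  simp only [powHom, AddMonoidHom.finset_sum_apply, AddMonoidHom.comp_apply]
  refine Finset.sum_congr rfl ?_
  intro i _
  have : (Pi.evalAddMonoidHom (fun _ : Fin m => ZMod n) i) x = (((x i).val : ℤ) : ZMod n) := by
    simp
  rw [this, ZMod.lift_coe]
  exact natCast_zsmul _ _

theorem Setup.exists_hom (h : Setup n d s S) (hN : NonHF S) :
    ∃ φ : (Fin (n - d - 1) → ZMod n) →+ G, Function.Injective φ := by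
  obtain ⟨A0, hA, hO, hlow⟩ := h.exists_low le_rfl hN
  obtain ⟨g0, hg0⟩ := Multiset.exists_mem_of_ne_zero hA.ne_zero
  obtain ⟨A, rfl⟩ := Multiset.exists_cons_of_mem hg0
  have hcard := h.low_card hA hO hlow
  have hnd := (Multiset.nodup_cons.1 (h.low_nodup hA hO hlow)).2
  rw [Multiset.card_cons] at hcard
  have hm : A.toFinset.card = n - d - 1 := by
    rw [Multiset.toFinset_card_of_nodup hnd]; omega
  let e := A.toFinset.equivFinOfCardEq hm
  let f : Fin (n - d - 1) → G := fun i => (e.symm i : G)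
  have hf : Function.Injective f := fun i j hij => e.symm.injective (Subtype.ext hij)
  have hfA : ∀ i, f i ∈ A := fun i => Multiset.mem_toFinset.1 (e.symm i).2
  haveI : NeZero n := ⟨h.hn.ne'⟩
  refine ⟨powHom h.hexp f, ?_⟩
  rw [injective_iff_map_eq_zero]
  intro x hx
  rw [powHom_apply] at hx
  set B : Multiset G := ∑ i, Multiset.replicate (x i).val (f i) with hB
  have hcount : ∀ i, B.count (f i) = (x i).val := by
    intro i
    rw [hB, Multiset.count_sum', Finset.sum_eq_single i]
    · simp
    · intro j _ hj
      rw [Multiset.count_replicate, if_neg (fun e => hj (hf e))]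
    · simp
  have hmem : ∀ g ∈ B, ∃ i, g = f i := by
    intro g hg
    obtain ⟨i, -, hi⟩ := Multiset.mem_sum.1 hg
    exact ⟨i, Multiset.eq_of_mem_replicate hi⟩
  have hB0 : B = 0 := by
    refine h.indep hA hO hlow (B := B) ?_ ?_ ?_
    · intro g hg
      obtain ⟨i, rfl⟩ := hmem g hg
      exact hfA i
    · rw [hB, Multiset.sum_sum]
      simpa using hx
    · intro g
      by_cases hg : g ∈ B
      · obtain ⟨i, rfl⟩ := hmem g hg
        rw [hcount]; exact ZMod.val_lt _
      · rw [Multiset.count_eq_zero_of_notMem hg]; exact h.hn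
  funext i
  have := hcount i
  rw [hB0, Multiset.count_zero] at this
  exact (ZMod.val_eq_zero _).1 this.symm

end NonLCN

open scoped Classical

section Extract

/-- Long sets of lengths, all elements congruent mod `d`. -/
def XX (d : ℕ) (L : Set (Set ℕ)) : Prop := ∀ N : ℕ, ∃ l ∈ L,
  (∀ a ∈ l, ∀ b ∈ l, (d : ℤ) ∣ (a : ℤ) - b) ∧ ∃ a ∈ l, ∃ b ∈ l, a + N ≤ b

/-- The same with large elasticity. -/
def XX2 (d : ℕ) (L : Set (Set ℕ)) : Prop := ∀ N : ℕ, ∃ l ∈ L,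
  (∀ a ∈ l, ∀ b ∈ l, (d : ℤ) ∣ (a : ℤ) - b) ∧ ∃ a ∈ l, ∃ b ∈ l, a + N ≤ b ∧ (d + 2) * a ≤ 2 * b

lemma XX2.xx {d : ℕ} {L : Set (Set ℕ)} (h : XX2 d L) : XX d L := by
  intro N
  obtain ⟨l, h1, h2, a, ha, b, hb, h3, -⟩ := h N
  exact ⟨l, h1, h2, a, ha, b, hb, h3⟩

variable {G : Type*} [AddCommGroup G] [Fintype G]

lemma atom_card_le {U : Multiset G} (hU : Atom U) : Multiset.card U ≤ Fintype.card G := by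
  by_contra hcon
  push Not at hcon
  induction U using Quotient.inductionOn with
  | h l =>
  have hcon' : Fintype.card G < l.length := hcon
  obtain ⟨i, j, hij, he⟩ := Fintype.exists_ne_map_eq_of_card_lt
    (fun i : Fin l.length => (l.take i).sum) (by simpa using hcon')
  wlog hlt : i < j generalizing i j
  · exact this j i hij.symm he.symm (lt_of_le_of_ne (not_lt.1 hlt) hij.symm)
  have hsub : ((l.take j).drop i).Sublist l := (List.drop_sublist _ _).trans (List.take_sublist _ _)
  have hlen : ((l.take j).drop i).length = j - i := by
    rw [List.length_drop, List.length_take]; have := j.2; omega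
  have hsum : ((l.take j).drop i).sum = 0 := by
    have h1 := List.sum_take_add_sum_drop (l.take j) i
    rw [List.take_take, min_eq_left (le_of_lt (Fin.lt_def.1 hlt))] at h1
    rw [he] at h1
    simpa using h1
  have h2 := hU.eq_of_le (T := ((l.take j).drop i : List G)) (Multiset.coe_le.2 hsub.subperm) (by
    intro h0
    have := congrArg Multiset.card h0
    simp only [Multiset.coe_card, hlen, Multiset.card_zero] at this
    have := Fin.lt_def.1 hlt
    omega) (by simpa using hsum)
  have h3 : ((l.take j).drop i).length = l.length := congrArg Multiset.card h2
  have := j.2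
  have := Fin.lt_def.1 hlt
  omega

lemma card_filter_le {p : G → Prop} [DecidablePred p] {B : Multiset G} {c : ℕ} (h : ∀ g, p g → B.count g ≤ c) :
    Multiset.card (B.filter p) ≤ Fintype.card G * c := by
  have h1 : Multiset.card (B.filter p) = ∑ g : G, (B.filter p).count g := by
    rw [Multiset.sum_count_eq_card]
    intro a _; exact Finset.mem_univ a
  rw [h1]
  have := Finset.sum_le_card_nsmul (Finset.univ : Finset G) (fun g => (B.filter p).count g) c (by
    intro g _
    by_cases hg : p g
    · simp only [Multiset.count_filter_of_pos hg]; exact h g hg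
    · simp only [Multiset.count_filter_of_neg hg]; omega)
  simpa using this

lemma extract_set (d : ℕ) : ∃ c : ℕ, ∀ B : Multiset G, B.sum = 0 →
    (∀ a b, HasLen B a → HasLen B b → (d : ℤ) ∣ (a : ℤ) - b) →
    ∃ G0 : Set G, Modd d G0 ∧ Multiset.card (B.filter (fun g => g ∉ G0)) ≤ c := by
  have hW : ∀ S : Set G, ∃ W : Multiset G, ¬ Modd d S → Over S W ∧ ∃ a b, HasLen W a ∧
      HasLen W b ∧ ¬ ((d : ℤ) ∣ (a : ℤ) - b) := by
    intro S
    by_cases h : Modd d S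
    · exact ⟨0, fun h' => absurd h h'⟩
    · have h' := h
      simp only [Modd] at h'
      push Not at h'
      obtain ⟨B, a, b, h1, h2, h3, h4⟩ := h'
      exact ⟨B, fun _ => ⟨h1, a, b, h2, h3, h4⟩⟩
  choose W hW using hW
  set c1 := ∑ S : Set G, Multiset.card (W S) with hc1
  refine ⟨Fintype.card G * c1, ?_⟩
  intro B hs hmod
  set G0 : Set G := {g | c1 ≤ B.count g} with hG0
  refine ⟨G0, ?_, ?_⟩
  · by_contra hcon
    obtain ⟨hO, a, b, ha, hb, hab⟩ := hW G0 hcon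
    have hle : W G0 ≤ B := by
      rw [Multiset.le_iff_count]
      intro g
      by_cases hg : g ∈ W G0
      · have h1 : c1 ≤ B.count g := hO g hg
        have h2 : Multiset.card (W G0) ≤ c1 :=
          Finset.single_le_sum (f := fun S : Set G => Multiset.card (W S))
            (fun _ _ => Nat.zero_le _) (Finset.mem_univ G0)
        exact (Multiset.count_le_card g _).trans (h2.trans h1)
      · rw [Multiset.count_eq_zero_of_notMem hg]; omega
    have hWs : (W G0).sum = 0 := by
      obtain ⟨F, hF, h, -⟩ := ha
      rw [← h]; exact hF.sum_sum
    obtain ⟨F, hF, hFs⟩ := exists_fact (sum_sub_zero hle hs hWs)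
    have hB : W G0 + F.sum = B := by rw [hFs]; exact add_tsub_cancel_of_le hle
    have h1 : HasLen B (a + Multiset.card F) := hB ▸ ha.add ⟨F, hF, rfl, rfl⟩
    have h2 : HasLen B (b + Multiset.card F) := hB ▸ hb.add ⟨F, hF, rfl, rfl⟩
    have := hmod _ _ h1 h2
    apply hab
    push_cast at this
    simpa using this
  · have := card_filter_le (p := fun g => g ∉ G0) (B := B) (c := c1)
      (fun g hg => (not_le.1 hg).le)
    convert this using 3

lemma extract_bound {n t c : ℕ} {B : Multiset G} {G0 : Set G}
    (hc : Multiset.card (B.filter (fun g => g ∉ G0)) ≤ c)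
    (hw : ∀ U : Multiset G, Atom U → Over G0 U → t ≤ wt n U ∧ wt n U ≤ n) {a b : ℕ}
    (ha : HasLen B a) (hb : HasLen B b) : t * b ≤ n * a + (n * Fintype.card G + t) * c := by
  have key : ∀ U : Multiset G, Atom U →
      t ≤ wt n U + t * Multiset.card (U.filter (fun g => g ∉ G0)) ∧
      wt n U ≤ n + n * Fintype.card G * Multiset.card (U.filter (fun g => g ∉ G0)) := by
    intro U hU
    by_cases hO : Over G0 U
    · obtain ⟨h1, h2⟩ := hw U hU hO
      exact ⟨h1.trans (Nat.le_add_right _ _), h2.trans (Nat.le_add_right _ _)⟩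
    · simp only [Over] at hO
      push Not at hO
      obtain ⟨g, hg, hg0⟩ := hO
      have h1 : 1 ≤ Multiset.card (U.filter (fun g => g ∉ G0)) :=
        Multiset.card_pos_iff_exists_mem.2 ⟨g, Multiset.mem_filter.2 ⟨hg, hg0⟩⟩
      have h2 := wt_le (n := n) U
      have h3 := Nat.mul_le_mul_left n (atom_card_le hU)
      have h4 := Nat.mul_le_mul_left t h1
      have h5 := Nat.mul_le_mul_left (n * Fintype.card G) h1
      constructor <;> omega
  have k1 : ∀ F : Multiset (Multiset G), Fctn F → t * Multiset.card F ≤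
      wt n F.sum + t * Multiset.card (F.sum.filter (fun g => g ∉ G0)) := by
    intro F
    induction F using Multiset.induction_on with
    | empty => simp
    | cons U F ih =>
      intro hF
      have h1 := ih (hF.mono (Multiset.le_cons_self _ _))
      have h2 := (key U (hF U (by simp))).1
      simp only [Multiset.card_cons, Multiset.sum_cons, wt_add, Multiset.filter_add,
        Multiset.card_add, mul_add, mul_one]
      omega
  have k2 : ∀ F : Multiset (Multiset G), Fctn F → wt n F.sum ≤ n * Multiset.card F +
      n * Fintype.card G * Multiset.card (F.sum.filter (fun g => g ∉ G0)) := by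
    intro F
    induction F using Multiset.induction_on with
    | empty => simp
    | cons U F ih =>
      intro hF
      have h1 := ih (hF.mono (Multiset.le_cons_self _ _))
      have h2 := (key U (hF U (by simp))).2
      simp only [Multiset.card_cons, Multiset.sum_cons, wt_add, Multiset.filter_add,
        Multiset.card_add, mul_add, mul_one]
      omega
  obtain ⟨F, hF, h1, h2⟩ := ha
  obtain ⟨F', hF', h1', h2'⟩ := hb
  have e1 := k2 F hF
  have e2 := k1 F' hF'
  rw [h1, h2] at e1
  rw [h1', h2'] at e2
  have e3 := Nat.mul_le_mul_left t hc
  have e4 := Nat.mul_le_mul_left (n * Fintype.card G) hc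
  rw [add_mul]
  omega

variable {n d s : ℕ}

lemma xx_unpack {N : ℕ} {P : ℕ → ℕ → Prop}
    (h : ∃ l ∈ systemL (Set.univ : Set G), (∀ a ∈ l, ∀ b ∈ l, (d : ℤ) ∣ (a : ℤ) - b) ∧
      ∃ a ∈ l, ∃ b ∈ l, P a b) : ∃ B : Multiset G, B.sum = 0 ∧
      (∀ a b, HasLen B a → HasLen B b → (d : ℤ) ∣ (a : ℤ) - b) ∧ ∃ a b, HasLen B a ∧ HasLen B b ∧
      P a b := by
  obtain ⟨l, ⟨B, hB, rfl⟩, h1, a, ha, b, hb, hP⟩ := h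
  exact ⟨B, hB.2, fun a b ha hb => h1 a (mem_lengthSet.2 ha) b (mem_lengthSet.2 hb), a, b,
    mem_lengthSet.1 ha, mem_lengthSet.1 hb, hP⟩

theorem xx_exists (hn : 0 < n) (hexp : ∀ g : G, n • g = 0)
    (h : XX d (systemL (Set.univ : Set G))) : ∃ S : Set G, Modd d S ∧ NonHF S := by
  by_contra hcon
  push Not at hcon
  obtain ⟨c, hc⟩ := extract_set (G := G) d
  obtain ⟨B, hs, hmod, a, b, ha, hb, hab⟩ := xx_unpack (N := 0)
    (h ((Fintype.card G + 1) * c + 1))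
  obtain ⟨G0, hG0, hcard⟩ := hc B hs hmod
  have h1 := extract_bound (n := n) (t := n) hcard (fun U hU hO => by
    rw [wt_eq_of_hf hexp (hcon G0 hG0) hU hO]; exact ⟨le_rfl, le_rfl⟩) ha hb
  have h2 := Nat.mul_le_mul_left n hab
  have : (n * Fintype.card G + n) * c = n * ((Fintype.card G + 1) * c) := by ring
  rw [this] at h1
  simp only [mul_add, mul_one] at h1 h2
  omega

theorem xx_bound (hn : 0 < n) (hexp : ∀ g : G, n • g = 0)
    (htor : ∀ p, 1 < p → Nat.card {x : G // p • x = 0} ≤ p ^ s)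
    (h : XX d (systemL (Set.univ : Set G))) : d + 2 ≤ n ∨ d + 1 ≤ s := by
  obtain ⟨S, h1, h2⟩ := xx_exists hn hexp h
  exact modd_bound hn hexp htor h1 h2

theorem xx_hom (hn : 0 < n) (hexp : ∀ g : G, n • g = 0)
    (htor : ∀ p, 1 < p → Nat.card {x : G // p • x = 0} ≤ p ^ s)
    (hsd : s ≤ d) (hnd : n < 2 * d + 2)
    (h : XX d (systemL (Set.univ : Set G))) :
    ∃ φ : (Fin (n - d - 1) → ZMod n) →+ G, Function.Injective φ := by
  obtain ⟨S, h1, h2⟩ := xx_exists hn hexp h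
  exact (Setup.mk hn hexp htor h1 hsd hnd : Setup n d s S).exists_hom h2

theorem not_xx2 (hn : 0 < n) (hexp : ∀ g : G, n • g = 0)
    (htor : ∀ p, 1 < p → Nat.card {x : G // p • x = 0} ≤ p ^ s)
    (hsd : s ≤ d) (hnd : n < 2 * d + 2) (hdn : d + 3 ≤ n) :
    ¬ XX2 d (systemL (Set.univ : Set G)) := by
  intro h
  obtain ⟨c, hc⟩ := extract_set (G := G) d
  set K := (n * Fintype.card G + (n - d)) * c with hK
  obtain ⟨B, hs, hmod, a, b, ha, hb, hab, hab2⟩ := xx_unpack (N := 0)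
    (h ((d + 2) * K + 1))
  obtain ⟨G0, hG0, hcard⟩ := hc B hs hmod
  have hset : Setup n d s G0 := ⟨hn, hexp, htor, hG0, hsd, hnd⟩
  have h1 := extract_bound (n := n) (t := n - d) hcard (fun U hU hO =>
    ⟨hset.le_wt hU hO, hset.wt_le hU hO⟩) ha hb
  rw [← hK] at h1
  obtain ⟨e, he⟩ := Nat.exists_eq_add_of_le hdn
  have hnd' : n - d = e + 3 := by omega
  rw [hnd'] at h1
  have hd1 : 1 ≤ d := by omega
  have h2 := Nat.mul_le_mul_left (d + 2) h1
  have h3 := Nat.mul_le_mul_left n hab2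
  have h4 : b ≤ (d + 2) * K := by
    have e1 : (d + 2) * (n * a + K) = n * ((d + 2) * a) + (d + 2) * K := by ring
    have e2 : (d + 2) * ((e + 3) * b) = n * (2 * b) + (d * (e + 1)) * b := by
      rw [he]; ring
    have e3 : 1 * b ≤ (d * (e + 1)) * b := Nat.mul_le_mul_right b (Nat.one_le_iff_ne_zero.2 (by positivity))
    omega
  omega

end Extract

open scoped Classical

section Transfer

variable {G H : Type*} [AddCommGroup G] [AddCommGroup H]

lemma lift_map {φ : H →+ G} (hφ : Function.Injective φ) {U : Multiset H} {T : Multiset G}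
    (hT : T ≤ U.map φ) : ∃ T' ≤ U, T = T'.map φ := by
  have h1 : T = (T.map (Function.invFun φ)).map φ := by
    rw [Multiset.map_map]
    conv_lhs => rw [← Multiset.map_id T]
    refine Multiset.map_congr rfl ?_
    intro g hg
    obtain ⟨x, -, rfl⟩ := Multiset.mem_map.1 (Multiset.mem_of_le hT hg)
    simp [Function.leftInverse_invFun hφ x]
  refine ⟨T.map (Function.invFun φ), ?_, h1⟩
  rw [h1] at hT
  exact (Multiset.map_le_map_iff hφ).1 hT

lemma atom_map {φ : H →+ G} (hφ : Function.Injective φ) {U : Multiset H} :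
    Atom (U.map φ) ↔ Atom U := by
  constructor
  · intro h
    refine Atom.mk' ?_ ?_ ?_
    · rintro rfl; exact h.ne_zero rfl
    · have := h.sum
      rw [← map_multiset_sum] at this
      exact (map_eq_zero_iff φ hφ).1 this
    · intro T hT hs
      rcases h.2.2.2 (T.map φ) (Multiset.map_le_map hT) (by rw [← map_multiset_sum, hs, map_zero])
        with h1 | h1
      · left; simpa using h1
      · right; exact Multiset.map_injective hφ h1
  · intro h
    refine Atom.mk' ?_ ?_ ?_
    · intro h0; exact h.ne_zero (by simpa using h0)
    · rw [← map_multiset_sum, h.sum, map_zero]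
    · intro T hT hs
      obtain ⟨T', hT', rfl⟩ := lift_map hφ hT
      rw [← map_multiset_sum] at hs
      rcases h.2.2.2 T' hT' ((map_eq_zero_iff φ hφ).1 hs) with h1 | h1
      · left; simp [h1]
      · right; rw [h1]

lemma fsum_map (φ : H → G) (F : Multiset (Multiset H)) :
    (F.map (Multiset.map φ)).sum = F.sum.map φ := by
  induction F using Multiset.induction_on with
  | empty => simp
  | cons U F ih => simp [ih]

lemma hasLen_map {φ : H →+ G} (hφ : Function.Injective φ) {B : Multiset H} {k : ℕ} :
    HasLen (B.map φ) k ↔ HasLen B k := by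
  constructor
  · rintro ⟨F, hF, hs, rfl⟩
    have h1 : ∀ U ∈ F, ∃ U' : Multiset H, U = U'.map φ := by
      intro U hU
      obtain ⟨U', -, h⟩ := lift_map hφ (hs ▸ Multiset.le_sum_of_mem hU)
      exact ⟨U', h⟩
    have h2 : ∃ F' : Multiset (Multiset H), F = F'.map (Multiset.map φ) := by
      clear hs hF
      induction F using Multiset.induction_on with
      | empty => exact ⟨0, by simp⟩
      | cons U F ih =>
        obtain ⟨U', hU'⟩ := h1 U (by simp)
        obtain ⟨F', hF'⟩ := ih (fun V hV => h1 V (Multiset.mem_cons_of_mem hV))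
        exact ⟨U' ::ₘ F', by simp [hU', hF']⟩
    obtain ⟨F', rfl⟩ := h2
    refine ⟨F', fun U hU => (atom_map hφ).1 (hF _ (Multiset.mem_map_of_mem _ hU)), ?_, by simp⟩
    rw [fsum_map] at hs
    exact Multiset.map_injective hφ hs
  · rintro ⟨F, hF, rfl, rfl⟩
    refine ⟨F.map (Multiset.map φ), ?_, fsum_map _ _, by simp⟩
    intro U hU
    obtain ⟨V, hV, rfl⟩ := Multiset.mem_map.1 hU
    exact (atom_map hφ).2 (hF V hV)

lemma systemL_sub {φ : H →+ G} (hφ : Function.Injective φ) :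
    systemL (Set.univ : Set H) ⊆ systemL (Set.univ : Set G) := by
  rintro l ⟨B, hB, rfl⟩
  refine ⟨B.map φ, ⟨fun _ _ => trivial, by rw [← map_multiset_sum, hB.2, map_zero]⟩, ?_⟩
  ext k
  rw [mem_lengthSet, mem_lengthSet, hasLen_map hφ]

lemma XX2.mono {d : ℕ} {L L' : Set (Set ℕ)} (h : XX2 d L) (hL : L ⊆ L') : XX2 d L' := by
  intro N
  obtain ⟨l, h1, h2⟩ := h N
  exact ⟨l, hL h1, h2⟩

end Transfer

section Crit

variable {G : Type*} [AddCommGroup G]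

lemma HasLen.sum_eq {B : Multiset G} {a : ℕ} (h : HasLen B a) : B.sum = 0 := by
  obtain ⟨F, hF, h, -⟩ := h
  rw [← h]; exact hF.sum_sum

lemma modd_of_fun {S : Set G} (f : G → ℤ) (c : ℤ) (d : ℕ) (hc : c ≠ 0)
    (h : ∀ U : Multiset G, Atom U → Over S U → c * d ∣ (U.map f).sum - c) : Modd d S := by
  have key : ∀ F : Multiset (Multiset G), Fctn F → Over S F.sum →
      c * d ∣ (F.sum.map f).sum - c * Multiset.card F := by
    intro F
    induction F using Multiset.induction_on with
    | empty => simp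
    | cons U F ih =>
      intro hF hO
      rw [Multiset.sum_cons] at hO
      have h1 := ih (hF.mono (Multiset.le_cons_self _ _)) (hO.le (Multiset.le_add_left _ _))
      have h2 := h U (hF U (by simp)) (hO.le (Multiset.le_add_right _ _))
      have h3 := dvd_add h1 h2
      have e : ((U ::ₘ F).sum.map f).sum - c * Multiset.card (U ::ₘ F) =
          (F.sum.map f).sum - c * Multiset.card F + ((U.map f).sum - c) := by
        simp only [Multiset.sum_cons, Multiset.map_add, Multiset.sum_add, Multiset.card_cons]
        push_cast
        ring
      rw [e]; exact h3
  rintro B a b hB ⟨F, hF, rfl, rfl⟩ ⟨F', hF', hs, rfl⟩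
  have h1 := key F hF hB
  have h2 := key F' hF' (hs ▸ hB)
  rw [hs] at h2
  have h3 := dvd_sub h2 h1
  have h4 : c * d ∣ c * ((Multiset.card F : ℤ) - Multiset.card F') := by
    have e : c * ((Multiset.card F : ℤ) - Multiset.card F') = (F.sum.map f).sum -
        c * Multiset.card F' - ((F.sum.map f).sum - c * Multiset.card F) := by ring
    rw [e]; exact h3
  exact (mul_dvd_mul_iff_left hc).1 h4

lemma xx_of_lens {S : Set G} {d : ℕ} (hS : Modd d S) {B : Multiset G} (hB : Over S B) {a b : ℕ}
    (ha : HasLen B a) (hb : HasLen B b) (hab : a < b) : XX d (systemL (Set.univ : Set G)) := by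
  intro N
  refine ⟨lengthSet Set.univ (N • B), ⟨N • B, ⟨fun _ _ => trivial, by
    simp [Multiset.sum_nsmul, ha.sum_eq]⟩, rfl⟩, ?_, N * a, mem_lengthSet.2 (ha.nsmul N), N * b,
    mem_lengthSet.2 (hb.nsmul N), ?_⟩
  · intro x hx y hy
    exact hS (N • B) x y (hB.nsmul N) (mem_lengthSet.1 hx) (mem_lengthSet.1 hy)
  · have := Nat.mul_le_mul_left N hab
    rw [Nat.succ_eq_add_one, mul_add] at this
    omega

lemma xx2_of_lens {S : Set G} {d : ℕ} (hS : Modd d S) {B : Multiset G} (hB : Over S B) {a b : ℕ}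
    (ha : HasLen B a) (hb : HasLen B b) (hab : a < b) (h2 : (d + 2) * a ≤ 2 * b) :
    XX2 d (systemL (Set.univ : Set G)) := by
  intro N
  refine ⟨lengthSet Set.univ (N • B), ⟨N • B, ⟨fun _ _ => trivial, by
    simp [Multiset.sum_nsmul, ha.sum_eq]⟩, rfl⟩, ?_, N * a, mem_lengthSet.2 (ha.nsmul N), N * b,
    mem_lengthSet.2 (hb.nsmul N), ?_, ?_⟩
  · intro x hx y hy
    exact hS (N • B) x y (hB.nsmul N) (mem_lengthSet.1 hx) (mem_lengthSet.1 hy)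
  · have := Nat.mul_le_mul_left N hab
    rw [Nat.succ_eq_add_one, mul_add] at this
    omega
  · have := Nat.mul_le_mul_left N h2
    calc (d + 2) * (N * a) = N * ((d + 2) * a) := by ring
      _ ≤ _ := this
      _ = _ := by ring

lemma mem_lengthSet' {S : Set G} {B : Multiset G} (hB : Over S B) {k : ℕ} :
    k ∈ lengthSet S B ↔ HasLen B k := by
  rw [← mem_lengthSet]
  constructor
  · rintro ⟨U, hU, h⟩
    exact ⟨U, fun i => ⟨(hU i).1, fun _ _ => trivial, (hU i).2.2⟩, h⟩
  · rintro ⟨U, hU, h⟩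
    refine ⟨U, fun i => ⟨(hU i).1, fun g hg => hB g ?_, (hU i).2.2⟩, h⟩
    rw [h]
    exact Multiset.mem_sum.2 ⟨i, Finset.mem_univ i, hg⟩

lemma mem_delta {S : Set G} {d : ℕ} : d ∈ deltaG0 S ↔ 0 < d ∧ ∃ B a, Over S B ∧ HasLen B a ∧
    HasLen B (a + d) ∧ ∀ c, HasLen B c → ¬ (a < c ∧ c < a + d) := by
  simp only [deltaG0, Set.mem_iUnion]
  constructor
  · rintro ⟨l, ⟨B, hB, rfl⟩, hd, a, ha, hb, hc⟩
    exact ⟨hd, B, a, hB.1, (mem_lengthSet' hB.1).1 ha, (mem_lengthSet' hB.1).1 hb,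
      fun c h => hc c ((mem_lengthSet' hB.1).2 h)⟩
  · rintro ⟨hd, B, a, hB, ha, hb, hc⟩
    exact ⟨_, ⟨B, ⟨hB, ha.sum_eq⟩, rfl⟩, hd, a, (mem_lengthSet' hB).2 ha, (mem_lengthSet' hB).2 hb,
      fun c h => hc c ((mem_lengthSet' hB).1 h)⟩

lemma mem_deltaStar_of {S : Set G} {d : ℕ} (hd : 0 < d) (hS : Modd d S) {B : Multiset G}
    (hB : Over S B) {a : ℕ} (ha : HasLen B a) (hb : HasLen B (a + d)) : d ∈ deltaStar G := by
  have hmem : d ∈ deltaG0 S := by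
    refine mem_delta.2 ⟨hd, B, a, hB, ha, hb, ?_⟩
    rintro c hc ⟨h1, h2⟩
    have := Int.le_of_dvd (by omega) (hS B c a hB hc ha)
    omega
  refine ⟨S, Set.nonempty_iff_ne_empty.1 ⟨d, hmem⟩, ?_⟩
  refine le_antisymm ?_ (Nat.sInf_le hmem)
  refine le_csInf ⟨d, hmem⟩ ?_
  intro e he
  obtain ⟨he0, B, a, hB, ha, hb, -⟩ := mem_delta.1 he
  have := hS B _ _ hB hb ha
  have := Int.le_of_dvd (by push_cast; omega) this
  push_cast at this
  omega

lemma deltaStar_xx {d : ℕ} (h : d ∈ deltaStar G) : XX d (systemL (Set.univ : Set G)) := by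
  obtain ⟨S, hne, hd⟩ := h
  have hmem : d ∈ deltaG0 S := hd ▸ Nat.sInf_mem (Set.nonempty_iff_ne_empty.2 hne)
  let D : AddSubgroup ℤ :=
    { carrier := {z | ∃ B a b, Over S B ∧ HasLen B a ∧ HasLen B b ∧ z = (a : ℤ) - b}
      add_mem' := by
        rintro x y ⟨B, a, b, hB, ha, hb, rfl⟩ ⟨B', a', b', hB', ha', hb', rfl⟩
        exact ⟨B + B', a + a', b + b', hB.add hB', ha.add ha', hb.add hb', by push_cast; ring⟩
      zero_mem' := ⟨0, 0, 0, by intro g hg; simp at hg, ⟨0, Fctn.zero, by simp, by simp⟩,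
        ⟨0, Fctn.zero, by simp, by simp⟩, by simp⟩
      neg_mem' := by
        rintro x ⟨B, a, b, hB, ha, hb, rfl⟩
        exact ⟨B, b, a, hB, hb, ha, by ring⟩ }
  have hD : ∀ z, z ∈ D ↔ ∃ B a b, Over S B ∧ HasLen B a ∧ HasLen B b ∧ z = (a : ℤ) - b :=
    fun z => Iff.rfl
  obtain ⟨e, he⟩ := Int.subgroup_cyclic D
  have hDe : ∀ z : ℤ, z ∈ D ↔ e ∣ z := by
    intro m
    rw [he, AddSubgroup.mem_closure_singleton]
    constructor
    · rintro ⟨k, rfl⟩; exact ⟨k, by simp [mul_comm]⟩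
    · rintro ⟨k, rfl⟩; exact ⟨k, by simp [mul_comm]⟩
  obtain ⟨hd0, B, a, hB, ha, hb, -⟩ := mem_delta.1 hmem
  have hdD : e ∣ (d : ℤ) := (hDe _).1 ((hD _).2 ⟨B, a + d, a, hB, hb, ha, by push_cast; ring⟩)
  have habs : (e.natAbs : ℤ) ∈ D := (hDe _).2 (Int.dvd_natAbs.2 dvd_rfl)
  have he0 : 0 < e.natAbs := by
    rcases Nat.eq_zero_or_pos e.natAbs with h | h
    · have : e = 0 := Int.natAbs_eq_zero.1 h
      rw [this, zero_dvd_iff] at hdD; omega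
    · exact h
  have hde : d ≤ e.natAbs := by
    obtain ⟨B', x, y, hB', hx, hy, hxy⟩ := (hD _).1 habs
    have hex : ∃ c, HasLen B' c ∧ y < c := ⟨x, hx, by omega⟩
    obtain ⟨h1, h2⟩ := Nat.find_spec hex
    have h3 : Nat.find hex ≤ x := Nat.find_min' hex ⟨hx, by omega⟩
    have : Nat.find hex - y ∈ deltaG0 S := by
      refine mem_delta.2 ⟨by omega, B', y, hB', hy, ?_, ?_⟩
      · rwa [Nat.add_sub_cancel' h2.le]
      · rintro c hc ⟨h4, h5⟩
        exact Nat.find_min hex (m := c) (by omega) ⟨hc, h4⟩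
    have := Nat.sInf_le this
    omega
  have hed : e.natAbs ∣ d := Int.natAbs_dvd_natAbs.2 hdD |>.trans (by simp)
  have hEd : e.natAbs = d := le_antisymm (Nat.le_of_dvd hd0 hed) hde
  have hS : Modd d S := by
    intro B' x y hB' hx hy
    have := (hDe _).1 ((hD _).2 ⟨B', x, y, hB', hx, hy, rfl⟩)
    rw [← hEd]
    exact Int.natAbs_dvd.2 this
  exact xx_of_lens hS hB ha hb (by omega)

end Crit

open scoped Classical

section Constr

variable {G : Type*} [AddCommGroup G]

lemma atom_small {U : Multiset G} (h0 : (0 : G) ∉ U) (hne : U ≠ 0) (hc : Multiset.card U ≤ 3)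
    (hs : U.sum = 0) : Atom U := by
  have one : ∀ T ≤ U, T.sum = 0 → Multiset.card T ≠ 1 := by
    intro T hT hTs h1
    obtain ⟨g, rfl⟩ := Multiset.card_eq_one.1 h1
    have : g = 0 := by simpa using hTs
    subst this
    exact h0 (Multiset.mem_of_le hT (by simp))
  refine Atom.mk' hne hs ?_
  intro T hT hTs
  have h1 := one T hT hTs
  have h2 := one (U - T) tsub_le_self (sum_sub_zero hT hs hTs)
  have h3 := Multiset.card_le_card hT
  rw [Multiset.card_sub hT] at h2
  rcases Nat.eq_zero_or_pos (Multiset.card T) with h | h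
  · left; exact Multiset.card_eq_zero.1 h
  · right; exact Multiset.eq_of_le_of_card_le hT (by omega)

lemma atom_pair {g : G} (hg : g ≠ 0) : Atom ({g, -g} : Multiset G) := by
  refine atom_small ?_ (by simp) (by simp) (by simp)
  simp [hg.symm, hg]

lemma one_mem_deltaStar {g : G} (hg : 3 ≤ addOrderOf g) : 1 ∈ deltaStar G := by
  have h1 : g ≠ 0 := by rintro rfl; simp at hg
  have h2 : g + g ≠ 0 := by
    intro h
    have := addOrderOf_le_of_nsmul_eq_zero (n := 2) (x := g) (by omega) (by rw [two_nsmul, h])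
    omega
  have h2' : -g + -g ≠ 0 := by
    intro h; apply h2; rw [← neg_add, neg_eq_zero] at h; exact h
  have hU : Atom ({g + g, -g, -g} : Multiset G) := by
    refine atom_small ?_ (by simp) (by simp) (by simp)
    simp [h1, h2.symm]
  have hV : Atom ({-g + -g, g, g} : Multiset G) := by
    refine atom_small ?_ (by simp) (by simp) (by simp)
    simp only [Multiset.insert_eq_cons, Multiset.mem_cons, Multiset.mem_singleton]
    rintro (h | h | h)
    · exact h2' h.symm
    · exact h1 h.symm
    · exact h1 h.symm
  refine mem_deltaStar_of (S := Set.univ) (d := 1) one_pos (fun B a b _ _ _ => by simp)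
    (B := {g + g, -g, -g} + {-g + -g, g, g}) (fun _ _ => trivial) (a := 2)
    ((HasLen.atom hU).add (HasLen.atom hV)) ?_
  have h3 := ((HasLen.atom (atom_pair h2)).add (HasLen.atom (atom_pair h1))).add
    (HasLen.atom (atom_pair h1))
  have e : ({g + g, -g, -g} + {-g + -g, g, g} : Multiset G) =
      {g + g, -(g + g)} + {g, -g} + {g, -g} := by
    rw [neg_add]
    simp only [Multiset.insert_eq_cons, ← Multiset.singleton_add]
    abel
  rw [e]; exact h3

lemma modd_pm [Finite G] {g : G} {n : ℕ} (hg : addOrderOf g = n) (hn : 3 ≤ n) :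
    Modd (n - 2) ({g, -g} : Set G) := by
  have h1 : g ≠ 0 := by rintro rfl; simp at hg; omega
  have h2 : -g ≠ g := by
    intro h
    have := addOrderOf_le_of_nsmul_eq_zero (n := 2) (x := g) (by omega)
      (by rw [two_nsmul]; nth_rewrite 1 [← h]; simp)
    omega
  have pure : ∀ (x : G) (U : Multiset G), Atom U → (∀ y ∈ U, y = x) → U = pw x := by
    intro x U hU h
    by_contra hne
    have h3 := count_lt_of_atom hU hne
    have h4 : U = Multiset.replicate (Multiset.card U) x := Multiset.eq_replicate_card.2 h
    have h5 := hU.sum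
    rw [h4, Multiset.count_replicate_self] at h3
    rw [h4, Multiset.sum_replicate] at h5
    have h6 := addOrderOf_le_of_nsmul_eq_zero (Multiset.card_pos.2 hU.ne_zero) h5
    omega
  refine modd_of_fun (fun x => if x = g then 1 else ((n : ℤ) - 1)) n (n - 2) (by omega) ?_
  intro U hU hO
  have hcast : ((n - 2 : ℕ) : ℤ) = n - 2 := by omega
  rw [hcast]
  by_cases ha : g ∈ U
  · by_cases hb : -g ∈ U
    · have hle : ({g, -g} : Multiset G) ≤ U := by
        rw [Multiset.le_iff_subset (by simp [h2.symm])]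
        intro x hx
        simp only [Multiset.insert_eq_cons, Multiset.mem_cons, Multiset.mem_singleton] at hx
        rcases hx with rfl | rfl
        · exact ha
        · exact hb
      have := hU.eq_of_le hle (by simp) (by simp)
      rw [← this]
      simp [h2]
    · have := pure g U hU (by
        intro y hy
        rcases hO y hy with h | h
        · exact h
        · rw [Set.mem_singleton_iff] at h; subst h; exact absurd hy hb)
      rw [this, pw, hg]
      simp
  · have := pure (-g) U hU (by
        intro y hy
        rcases hO y hy with h | h
        · subst h; exact absurd hy ha
        · exact h)
    rw [this, pw, addOrderOf_neg, hg]
    simp only [Multiset.map_replicate, Multiset.sum_replicate, if_neg h2]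
    refine ⟨1, ?_⟩
    simp
    ring

lemma pm_lens [Finite G] {g : G} {n : ℕ} (hg : addOrderOf g = n) (hn : 3 ≤ n) :
    ∃ B, Over ({g, -g} : Set G) B ∧ HasLen B 2 ∧ HasLen B (2 + (n - 2)) := by
  have h1 : g ≠ 0 := by rintro rfl; simp at hg; omega
  refine ⟨pw g + pw (-g), (pw_over (by simp)).add (pw_over (by simp)),
    (HasLen.atom (pw_atom g)).add (HasLen.atom (pw_atom (-g))), ?_⟩
  have h2 := hasLen_nsmul_atom (atom_pair h1) n
  have e : n • ({g, -g} : Multiset G) = pw g + pw (-g) := by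
    rw [pw, pw, addOrderOf_neg, hg, Multiset.insert_eq_cons, ← Multiset.singleton_add, nsmul_add,
      Multiset.nsmul_singleton, Multiset.nsmul_singleton]
  rw [e] at h2
  convert h2 using 1
  omega

lemma exp_mem_deltaStar [Finite G] {g : G} {n : ℕ} (hg : addOrderOf g = n) (hn : 3 ≤ n) :
    n - 2 ∈ deltaStar G := by
  obtain ⟨B, hB, h1, h2⟩ := pm_lens hg hn
  exact mem_deltaStar_of (by omega) (modd_pm hg hn) hB h1 h2

end Constr

section Basis

variable {d m : ℕ}

/-- Unit vectors. -/
def ee (d m : ℕ) (i : Fin (d + 1)) : Fin (d + 1) → ZMod m := Pi.single i 1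

/-- Unit vectors and the all-one vector. -/
def SS (d m : ℕ) : Set (Fin (d + 1) → ZMod m) := {u | u = 1 ∨ ∃ i, u = ee d m i}

lemma count_eq_ite {α : Type*} [DecidableEq α] (U : Multiset α) (a : α) :
    U.count a = (U.map (fun u => if u = a then 1 else 0)).sum := by
  induction U using Multiset.induction_on with
  | empty => simp
  | cons x U ih =>
    rw [Multiset.count_cons, ih]
    by_cases h : x = a
    · subst h; simp; omega
    · have : ¬ a = x := fun h' => h h'.symm
      simp [h, this]

lemma ee_ne_one (hd : 1 ≤ d) (hm : 2 ≤ m) (i : Fin (d + 1)) : ee d m i ≠ 1 := by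
  haveI : Fact (1 < m) := ⟨hm⟩
  obtain ⟨j, hj⟩ : ∃ j : Fin (d + 1), j ≠ i := by
    haveI : Nontrivial (Fin (d + 1)) := Fin.nontrivial_iff_two_le.2 (by omega)
    exact exists_ne i
  intro h
  have := congrFun h j
  simp [ee, hj] at this

lemma ee_inj (hm : 2 ≤ m) : Function.Injective (ee d m) := by
  haveI : Fact (1 < m) := ⟨hm⟩
  intro i j h
  by_contra hne
  have := congrFun h i
  simp [ee, hne] at this

lemma SS_val (hd : 1 ≤ d) (hm : 2 ≤ m) {u : Fin (d + 1) → ZMod m} (hu : u ∈ SS d m)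
    (i : Fin (d + 1)) : (u i).val = (if u = 1 then 1 else 0) + (if u = ee d m i then 1 else 0) := by
  haveI : Fact (1 < m) := ⟨hm⟩
  rcases hu with rfl | ⟨j, rfl⟩
  · rw [if_pos rfl, if_neg (ee_ne_one hd hm i).symm]
    simp [ZMod.val_one]
  · rw [if_neg (ee_ne_one hd hm j)]
    by_cases hij : j = i
    · subst hij; simp [ee, ZMod.val_one]
    · rw [if_neg (fun h => hij (ee_inj hm h))]
      simp [ee, Ne.symm hij]

lemma exp_pi (x : Fin (d + 1) → ZMod m) : m • x = 0 := by
  funext i; simp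

lemma ord_SS (hm : 2 ≤ m) {u : Fin (d + 1) → ZMod m} (hu : u ∈ SS d m) : addOrderOf u = m := by
  refine Nat.dvd_antisymm (addOrderOf_dvd_of_nsmul_eq_zero (exp_pi u)) ?_
  have key : ∀ i, u i = 1 → m ∣ addOrderOf u := by
    intro i hi
    have := addOrderOf_map_dvd (Pi.evalAddMonoidHom (fun _ : Fin (d + 1) => ZMod m) i) u
    simpa [hi, ZMod.addOrderOf_one] using this
  rcases hu with rfl | ⟨j, rfl⟩
  · exact key 0 rfl
  · exact key j (by simp [ee])

lemma coord_sum (hd : 1 ≤ d) (hm : 2 ≤ m) {U : Multiset (Fin (d + 1) → ZMod m)}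
    (hU : Over (SS d m) U) (i : Fin (d + 1)) :
    (U.map (fun u => (u i).val)).sum = U.count 1 + U.count (ee d m i) := by
  rw [count_eq_ite, count_eq_ite, ← Multiset.sum_map_add]
  congr 1
  refine Multiset.map_congr rfl ?_
  intro u hu
  rw [SS_val hd hm (hU u hu) i]

lemma coord_dvd (hm : 2 ≤ m) {U : Multiset (Fin (d + 1) → ZMod m)} (hs : U.sum = 0)
    (i : Fin (d + 1)) : m ∣ (U.map (fun u => (u i).val)).sum := by
  haveI : NeZero m := ⟨by omega⟩
  rw [← ZMod.natCast_eq_zero_iff]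
  have : ∀ V : Multiset (Fin (d + 1) → ZMod m), (((V.map (fun u => (u i).val)).sum : ℕ) : ZMod m) =
      V.sum i := by
    intro V
    induction V using Multiset.induction_on with
    | empty => simp
    | cons u V ih => simp [ih]
  rw [this, hs]; rfl

lemma SS_atom (hd : 1 ≤ d) (hm : 2 ≤ m) {U : Multiset (Fin (d + 1) → ZMod m)} (hA : Atom U)
    (hU : Over (SS d m) U) (hne : ∀ u ∈ SS d m, U.count u < m) (i : Fin (d + 1)) :
    U.count 1 + U.count (ee d m i) = m := by
  haveI : NeZero m := ⟨by omega⟩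
  have hdv : ∀ i, m ∣ U.count 1 + U.count (ee d m i) := by
    intro i
    rw [← coord_sum hd hm hU i]; exact coord_dvd hm hA.sum i
  have h1 := hne 1 (Or.inl rfl)
  have h1' : 0 < U.count 1 := by
    by_contra hcon
    have h0 : U.count 1 = 0 := by omega
    apply hA.ne_zero
    rw [Multiset.eq_zero_iff_forall_notMem]
    intro u hu
    rcases hU u hu with rfl | ⟨j, rfl⟩
    · exact (Multiset.count_pos.2 hu).ne' h0
    · have h2 := hdv j
      rw [h0, zero_add] at h2
      have h3 := Nat.le_of_dvd (Multiset.count_pos.2 hu) h2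
      have h4 := hne _ (Or.inr ⟨j, rfl⟩)
      omega
  have h2 := hne (ee d m i) (Or.inr ⟨i, rfl⟩)
  obtain ⟨k, hk⟩ := hdv i
  have hk1 : 0 < k := by
    rcases Nat.eq_zero_or_pos k with h | h
    · subst h; rw [mul_zero] at hk; omega
    · exact h
  have hk2 : k < 2 := by
    by_contra hc
    have : m * 2 ≤ m * k := Nat.mul_le_mul_left m (by omega)
    omega
  have : k = 1 := by omega
  subst this; omega

lemma modd_SS (hd : 1 ≤ d) (hm : 2 ≤ m) : Modd d (SS d m) := by
  haveI : NeZero m := ⟨by omega⟩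
  haveI : Fact (1 < m) := ⟨hm⟩
  refine modd_of_fun (fun u => ∑ i, ((u i).val : ℤ)) m d (by omega) ?_
  intro U hA hU
  have hF : (U.map (fun u => ∑ i, ((u i).val : ℤ))).sum =
      ∑ i, ((U.count 1 + U.count (ee d m i) : ℕ) : ℤ) := by
    have e : ∀ V : Multiset (Fin (d + 1) → ZMod m), (V.map (fun u => ∑ i, ((u i).val : ℤ))).sum =
        ∑ i, (((V.map (fun u => (u i).val)).sum : ℕ) : ℤ) := by
      intro V
      induction V using Multiset.induction_on with
      | empty => simp
      | cons u V ih =>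
        rw [Multiset.map_cons, Multiset.sum_cons, ih, ← Finset.sum_add_distrib]
        refine Finset.sum_congr rfl ?_
        intro i _
        rw [Multiset.map_cons, Multiset.sum_cons]; push_cast; rfl
    rw [e]
    refine Finset.sum_congr rfl ?_
    intro i _
    rw [← coord_sum hd hm hU i]
  rw [hF]
  by_cases hex : ∃ u ∈ SS d m, m ≤ U.count u
  · obtain ⟨u, hu, hc⟩ := hex
    have hUp : U = pw u := by
      by_contra hne
      have : U.count u < addOrderOf u := by convert count_lt_of_atom hA hne
      rw [ord_SS hm hu] at this; omega
    rw [hUp, pw, ord_SS hm hu]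
    rcases hu with rfl | ⟨j, rfl⟩
    · have : ∀ i, (Multiset.replicate m (1 : Fin (d + 1) → ZMod m)).count (ee d m i) = 0 := by
        intro i
        rw [Multiset.count_replicate, if_neg (ee_ne_one hd hm i).symm]
      simp only [this, Multiset.count_replicate_self]
      simp
      exact ⟨1, by ring⟩
    · have : ∀ i, (Multiset.replicate m (ee d m j)).count (ee d m i) = if i = j then m else 0 := by
        intro i
        rw [Multiset.count_replicate]
        by_cases h : i = j
        · simp [h]
        · rw [if_neg (fun h' => h (ee_inj hm h').symm), if_neg h]
      have h0 : (Multiset.replicate m (ee d m j)).count 1 = 0 := by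
        rw [Multiset.count_replicate, if_neg (ee_ne_one hd hm j)]
      simp only [this, h0]
      simp
  · push Not at hex
    have := fun i => SS_atom hd hm hA hU hex i
    simp only [this]
    simp
    exact ⟨1, by ring⟩

lemma basis_atom (hd : 1 ≤ d) (hm : 2 ≤ m) :
    ∃ V : Multiset (Fin (d + 1) → ZMod m), Over (SS d m) V ∧ Atom V ∧
      Multiset.card V = 1 + (d + 1) * (m - 1) := by
  haveI : NeZero m := ⟨by omega⟩
  haveI : Fact (1 < m) := ⟨hm⟩
  set V : Multiset (Fin (d + 1) → ZMod m) := {1} + ∑ i, Multiset.replicate (m - 1) (ee d m i)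
    with hV
  have hVO : Over (SS d m) V := by
    intro u hu
    rcases Multiset.mem_add.1 hu with h | h
    · left; simpa using h
    · obtain ⟨i, -, hi⟩ := Multiset.mem_sum.1 h
      right; exact ⟨i, Multiset.eq_of_mem_replicate hi⟩
  have hc1 : V.count 1 = 1 := by
    rw [hV, Multiset.count_add, Multiset.count_sum', Finset.sum_eq_zero]
    · simp
    · intro i _
      rw [Multiset.count_replicate, if_neg (ee_ne_one hd hm i)]
  have hce : ∀ j, V.count (ee d m j) = m - 1 := by
    intro j
    rw [hV, Multiset.count_add, Multiset.count_sum', Finset.sum_eq_single j]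
    · simp [ee_ne_one hd hm j]
    · intro i _ hij
      rw [Multiset.count_replicate, if_neg (fun h => hij (ee_inj hm h))]
    · simp
  have hVs : V.sum = 0 := by
    rw [hV, Multiset.sum_add, Multiset.sum_sum]
    funext j
    simp [ee, Finset.sum_apply, Pi.single_apply]
    rw [Nat.cast_sub (by omega)]; simp
  have hV0 : V ≠ 0 := by intro h; rw [h] at hc1; simp at hc1
  have hVA : Atom V := by
    obtain ⟨U, hle, hA⟩ := exists_atom_le hV0 hVs
    have hcl := Multiset.le_iff_count.1 hle
    have := fun i => SS_atom hd hm hA (hVO.le hle) (by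
      rintro u (rfl | ⟨i, rfl⟩)
      · have := hcl 1; omega
      · have := hcl (ee d m i); rw [hce] at this; omega) i
    have hVU : V ≤ U := by
      rw [Multiset.le_iff_count]
      intro u
      by_cases hu : u ∈ V
      · rcases hVO u hu with rfl | ⟨i, rfl⟩
        · have h1 := this 0
          have h2 := hcl (ee d m 0)
          rw [hce] at h2
          omega
        · have h1 := this i
          have h2 := hcl 1
          rw [hce]; omega
      · rw [Multiset.count_eq_zero_of_notMem hu]; omega
    rw [le_antisymm hVU hle]; exact hA
  have hcard : Multiset.card V = 1 + (d + 1) * (m - 1) := by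
    rw [hV, Multiset.card_add, Multiset.card_sum]; simp
  exact ⟨V, hVO, hVA, hcard⟩

theorem xx2_basis (hd : 1 ≤ d) (hm : 2 ≤ m) :
    XX2 d (systemL (Set.univ : Set (Fin (d + 1) → ZMod m))) := by
  haveI : NeZero m := ⟨by omega⟩
  haveI : Fact (1 < m) := ⟨hm⟩
  obtain ⟨V, hVO, hVA, hcard⟩ := basis_atom hd hm
  have hwt : wt m V = 1 + (d + 1) * (m - 1) := by
    rw [← hcard, wt, Multiset.map_congr rfl (g := fun _ => 1)]
    · simp
    · intro u hu; rw [ord_SS hm (hVO u hu)]; exact Nat.div_self (by omega)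
  have hl := hasLen_nsmul_wt (n := m) exp_pi V
  rw [hwt] at hl
  obtain ⟨k, rfl⟩ := Nat.exists_eq_add_of_le hm
  obtain ⟨e, rfl⟩ := Nat.exists_eq_add_of_le hd
  have h21 : 2 + k - 1 = k + 1 := by omega
  rw [h21] at hl
  refine xx2_of_lens (modd_SS hd hm) (hVO.nsmul _) (hasLen_nsmul_atom hVA _) hl ?_ ?_
  · nlinarith [Nat.zero_le (e * k)]
  · nlinarith [Nat.zero_le (e * k)]

end Basis

open scoped Classical

section Data

/-- The group data used in the argument. -/
structure GD (G : Type*) [AddCommGroup G] [Fintype G] (n m r : ℕ) : Prop where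
  hexp : ∀ g : G, n • g = 0
  hord : ∃ g : G, addOrderOf g = n
  htor : ∀ p, 1 < p → Nat.card {x : G // p • x = 0} ≤ p ^ r
  hm : 2 ≤ m
  hmn : m ∣ n
  hn : 0 < n
  hom : ∀ q, q ≤ r → ∃ φ : (Fin q → ZMod m) →+ G, Function.Injective φ
  hcard : Fintype.card G ≤ n ^ r

lemma zmod_emb {m k : ℕ} (hk : 0 < k) (h : m ∣ k) :
    ∃ ψ : ZMod m →+ ZMod k, Function.Injective ψ := by
  obtain ⟨c, rfl⟩ := h
  have hm : 0 < m := Nat.pos_of_mul_pos_right hk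
  have hc : 0 < c := Nat.pos_of_mul_pos_left hk
  haveI : NeZero m := ⟨hm.ne'⟩
  refine ⟨ZMod.lift m ⟨zmultiplesHom _ ((c : ℕ) : ZMod (m * c)), ?_⟩, ?_⟩
  · simp only [zmultiplesHom_apply, natCast_zsmul, nsmul_eq_mul]
    rw [← Nat.cast_mul, ZMod.natCast_self]
  · rw [injective_iff_map_eq_zero]
    intro x hx
    have e : x = (((x.val : ℕ) : ℤ) : ZMod m) := by simp
    rw [e, ZMod.lift_coe] at hx
    have hx' : ((x.val : ℕ) : ℤ) • ((c : ℕ) : ZMod (m * c)) = 0 := hx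
    rw [natCast_zsmul, nsmul_eq_mul, ← Nat.cast_mul, ZMod.natCast_eq_zero_iff] at hx'
    have h1 := Nat.dvd_of_mul_dvd_mul_right hc hx'
    have h2 := ZMod.val_lt x
    exact (ZMod.val_eq_zero x).1 (Nat.eq_zero_of_dvd_of_lt h1 h2)

lemma GD_of {G : Type*} [AddCommGroup G] [Fintype G] (r : ℕ) (hr : 0 < r) (n : Fin r → ℕ)
    (hn : ∀ i, 1 < n i) (hdvd : ∀ i j : Fin r, i ≤ j → n i ∣ n j)
    (hG : Nonempty (G ≃+ (∀ i : Fin r, ZMod (n i)))) :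
    GD G (n ⟨r - 1, by omega⟩) (n ⟨0, hr⟩) r := by
  obtain ⟨e⟩ := hG
  set N := n ⟨r - 1, by omega⟩ with hN
  have hdN : ∀ i, n i ∣ N := fun i => hdvd _ _ (Fin.le_def.2 (by have := i.2; simp; omega))
  have h0d : ∀ i, n ⟨0, hr⟩ ∣ n i := fun i => hdvd _ _ (Fin.le_def.2 (by simp))
  haveI : ∀ i, NeZero (n i) := fun i => ⟨by have := hn i; omega⟩
  have hexp : ∀ g : G, N • g = 0 := by
    intro g
    apply e.injective
    rw [map_nsmul, map_zero]
    funext i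
    simp only [Pi.smul_apply, nsmul_eq_mul, Pi.zero_apply]
    rw [(ZMod.natCast_eq_zero_iff _ _).2 (hdN i), zero_mul]
  refine ⟨hexp, ?_, ?_, hn _, h0d _, by have := hn ⟨r - 1, by omega⟩; omega, ?_, ?_⟩
  · refine ⟨e.symm (Pi.single ⟨r - 1, by omega⟩ 1), ?_⟩
    refine Nat.dvd_antisymm (addOrderOf_dvd_of_nsmul_eq_zero (hexp _)) ?_
    have := addOrderOf_map_dvd ((Pi.evalAddMonoidHom (fun i : Fin r => ZMod (n i))
      ⟨r - 1, by omega⟩).comp e.toAddMonoidHom) (e.symm (Pi.single ⟨r - 1, by omega⟩ 1))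
    simpa [ZMod.addOrderOf_one] using this
  · intro p hp
    let f : {x : G // p • x = 0} → (∀ i : Fin r, {y : ZMod (n i) // p • y = 0}) :=
      fun x i => ⟨e x.1 i, by
        have := congrArg e x.2
        rw [map_nsmul, map_zero] at this
        exact congrFun this i⟩
    have hf : Function.Injective f := by
      intro x y h
      apply Subtype.ext
      apply e.injective
      funext i
      exact congrArg Subtype.val (congrFun h i)
    refine (Nat.card_le_card_of_injective f hf).trans ?_
    rw [Nat.card_pi]
    have : ∀ i ∈ (Finset.univ : Finset (Fin r)), Nat.card {y : ZMod (n i) // p • y = 0} ≤ p := by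
      intro i _
      have := IsAddCyclic.card_nsmul_eq_zero_le (α := ZMod (n i)) (n := p) (by omega)
      rw [Nat.card_eq_fintype_card, Fintype.card_subtype]
      convert this
    refine (Finset.prod_le_pow_card _ _ _ this).trans ?_
    simp
  · intro q hq
    choose ψ hψ using fun i => zmod_emb (m := n ⟨0, hr⟩) (k := n i) (by have := hn i; omega) (h0d i)
    let φ : (Fin q → ZMod (n ⟨0, hr⟩)) →+ (∀ i : Fin r, ZMod (n i)) :=
      { toFun := fun x i => if h : (i : ℕ) < q then ψ i (x ⟨i, h⟩) else 0
        map_zero' := by funext i; simp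
        map_add' := by
          intro x y; funext i
          by_cases h : (i : ℕ) < q
          · simp [h]
          · simp [h] }
    refine ⟨e.symm.toAddMonoidHom.comp φ, e.symm.injective.comp ?_⟩
    intro x y hxy
    funext j
    have h1 := congrFun hxy ⟨j, by have := j.2; omega⟩
    simp only [φ, AddMonoidHom.coe_mk, ZeroHom.coe_mk, j.2, dite_true] at h1
    exact hψ _ h1
  · rw [Fintype.card_congr e.toEquiv, Fintype.card_pi]
    have : ∀ i ∈ (Finset.univ : Finset (Fin r)), Fintype.card (ZMod (n i)) ≤ N := by
      intro i _
      rw [ZMod.card]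
      exact Nat.le_of_dvd (by have := hn ⟨r - 1, by omega⟩; omega) (hdN i)
    refine (Finset.prod_le_pow_card _ _ _ this).trans ?_
    simp

lemma rank_le_of_hom {G : Type*} [AddCommGroup G] [Fintype G] {q m s : ℕ} (hm : 2 ≤ m)
    (htor : ∀ p, 1 < p → Nat.card {x : G // p • x = 0} ≤ p ^ s)
    {φ : (Fin q → ZMod m) →+ G} (hφ : Function.Injective φ) : q ≤ s := by
  haveI : NeZero m := ⟨by omega⟩
  let f : (Fin q → ZMod m) → {x : G // m • x = 0} := fun x => ⟨φ x, by
    rw [← map_nsmul]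
    have : m • x = 0 := by funext i; simp
    rw [this, map_zero]⟩
  have hf : Function.Injective f := fun x y h => hφ (congrArg Subtype.val h)
  have h1 := (Nat.card_le_card_of_injective f hf).trans (htor m (by omega))
  rw [Nat.card_eq_fintype_card, Fintype.card_pi] at h1
  simp only [ZMod.card, Finset.prod_const, Finset.card_univ, Fintype.card_fin] at h1
  exact (Nat.pow_le_pow_iff_right (by omega)).1 h1

variable {G : Type*} [AddCommGroup G]

lemma Atom.zero_mem {U : Multiset G} (hU : Atom U) (h : (0 : G) ∈ U) : U = {0} :=
  (hU.eq_of_le (T := {0}) (Multiset.singleton_le.2 h) (by simp) (by simp)).symm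

lemma Atom.two_le {U : Multiset G} (hU : Atom U) (h : (0 : G) ∉ U) : 2 ≤ Multiset.card U := by
  by_contra hc
  have h1 := Multiset.card_pos.2 hU.ne_zero
  obtain ⟨g, rfl⟩ := Multiset.card_eq_one.1 (show Multiset.card U = 1 by omega)
  have : g = 0 := by simpa using hU.sum
  subst this; simp at h

/-- Some set of lengths contains 2 and `l`. -/
def YY (l : ℕ) (L : Set (Set ℕ)) : Prop := ∃ x ∈ L, 2 ∈ x ∧ l ∈ x

lemma yy_of_atom {U : Multiset G} (hU : Atom U) (h2 : 2 ≤ Multiset.card U) :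
    YY (Multiset.card U) (systemL (Set.univ : Set G)) := by
  have h0 : (0 : G) ∉ U := by
    intro h; rw [hU.zero_mem h] at h2; simp at h2
  have hneg : Atom (U.map (negAddMonoidHom : G →+ G)) :=
    (atom_map (φ := (negAddMonoidHom : G →+ G)) neg_injective).2 hU
  refine ⟨lengthSet Set.univ (U + U.map (negAddMonoidHom : G →+ G)), ⟨_, ⟨fun _ _ => trivial, by
    rw [Multiset.sum_add, hU.sum, hneg.sum, add_zero]⟩, rfl⟩, ?_, ?_⟩
  · exact mem_lengthSet.2 ((HasLen.atom hU).add (HasLen.atom hneg))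
  · rw [mem_lengthSet]
    clear hneg hU h2
    induction U using Multiset.induction_on with
    | empty => exact ⟨0, Fctn.zero, by simp, by simp⟩
    | cons g U ih =>
      have hg : g ≠ 0 := by rintro rfl; simp at h0
      have h1 := (ih (fun h => h0 (Multiset.mem_cons_of_mem h))).add (HasLen.atom (atom_pair hg))
      rw [Multiset.card_cons]
      convert h1 using 1
      rw [Multiset.map_cons, Multiset.insert_eq_cons, ← Multiset.singleton_add,
        ← Multiset.singleton_add, ← Multiset.singleton_add]
      simp only [negAddMonoidHom, AddMonoidHom.coe_mk, ZeroHom.coe_mk]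
      abel

lemma card_fsum (F : Multiset (Multiset G)) :
    Multiset.card F.sum = (F.map Multiset.card).sum := by
  induction F using Multiset.induction_on with
  | empty => simp
  | cons U F ih => simp [ih]

lemma two_mul_card_le {F : Multiset (Multiset G)} (hF : Fctn F) (h0 : (0 : G) ∉ F.sum) :
    2 * Multiset.card F ≤ Multiset.card F.sum := by
  rw [card_fsum]
  have := Multiset.card_nsmul_le_sum (s := F.map Multiset.card) (a := 2) (by
    intro x hx
    obtain ⟨U, hU, rfl⟩ := Multiset.mem_map.1 hx
    exact (hF U hU).two_le (fun h => h0 (Multiset.mem_of_le (Multiset.le_sum_of_mem hU) h)))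
  simpa [mul_comm] using this

lemma atom_len {U : Multiset G} (hU : Atom U) {k : ℕ} (h : HasLen U k) : k = 1 := by
  obtain ⟨F, hF, hs, rfl⟩ := h
  have h0 : F ≠ 0 := by rintro rfl; exact hU.ne_zero (by simpa using hs.symm)
  obtain ⟨V, hV⟩ := Multiset.exists_mem_of_ne_zero h0
  have hVU : V = U := hU.eq_of_le (hs ▸ Multiset.le_sum_of_mem hV) (hF V hV).ne_zero (hF V hV).sum
  obtain ⟨F', rfl⟩ := Multiset.exists_cons_of_mem hV
  rw [Multiset.sum_cons, hVU] at hs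
  have hs' : F'.sum = 0 := by simpa using hs
  have : F' = 0 := by
    rw [Multiset.eq_zero_iff_forall_notMem]
    intro W hW
    have h1 : W ≤ F'.sum := Multiset.le_sum_of_mem hW
    rw [hs'] at h1
    exact (hF W (Multiset.mem_cons_of_mem hW)).ne_zero (Multiset.le_zero.1 h1)
  simp [this]

lemma len_zero_cons {U : Multiset G} (hU : Atom U) {l : ℕ} (h : HasLen ({0} + U) l) : l = 2 := by
  obtain ⟨F, hF, hs, rfl⟩ := h
  have h0 : (0 : G) ∈ F.sum := by rw [hs]; simp
  obtain ⟨V, hV, h0V⟩ := Multiset.mem_join.1 h0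
  have := (hF V hV).zero_mem h0V
  obtain ⟨F', rfl⟩ := Multiset.exists_cons_of_mem hV
  rw [Multiset.sum_cons, this] at hs
  have := atom_len hU ⟨F', hF.mono (Multiset.le_cons_self _ _), add_left_cancel hs, rfl⟩
  simp [this]

lemma atom_of_yy {l : ℕ} (hl : 3 ≤ l) (h : YY l (systemL (Set.univ : Set G))) :
    ∃ U : Multiset G, Atom U ∧ l ≤ Multiset.card U := by
  obtain ⟨x, ⟨B, hB, rfl⟩, h2, h3⟩ := h
  rw [mem_lengthSet] at h2 h3
  obtain ⟨F, hF, rfl, hc⟩ := h2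
  obtain ⟨U, V, rfl⟩ := Multiset.card_eq_two.1 hc
  have hU := hF U (by simp)
  have hV := hF V (by simp)
  have hs : (({U, V} : Multiset (Multiset G))).sum = U + V := by simp
  rw [hs] at h3
  have h0U : (0 : G) ∉ U := by
    intro h
    rw [hU.zero_mem h] at h3
    have := len_zero_cons hV h3; omega
  have h0V : (0 : G) ∉ V := by
    intro h
    rw [hV.zero_mem h, add_comm] at h3
    have := len_zero_cons hU h3; omega
  obtain ⟨F', hF', hs', rfl⟩ := h3
  have h4 := two_mul_card_le hF' (by rw [hs']; simp [h0U, h0V])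
  rw [hs', Multiset.card_add] at h4
  by_cases h5 : Multiset.card F' ≤ Multiset.card U
  · exact ⟨U, hU, h5⟩
  · exact ⟨V, hV, by omega⟩

lemma atom_extend {H : Type*} [AddCommGroup H] {φ : H →+ G} (hφ : Function.Injective φ)
    (hns : ¬ Function.Surjective φ) {U : Multiset H} (hU : Atom U) :
    ∃ V : Multiset G, Atom V ∧ Multiset.card V = Multiset.card U + 1 := by
  simp only [Function.Surjective] at hns
  push Not at hns
  obtain ⟨g, hg⟩ := hns
  obtain ⟨u, hu⟩ := Multiset.exists_mem_of_ne_zero hU.ne_zero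
  obtain ⟨U', rfl⟩ := Multiset.exists_cons_of_mem hu
  have hA := (atom_map hφ).2 hU
  rw [Multiset.map_cons] at hA
  set W := U'.map φ with hW
  have hWr : ∀ T : Multiset G, T ≤ W → ∃ y, T.sum = φ y := by
    intro T hT
    obtain ⟨T', -, rfl⟩ := lift_map hφ hT
    exact ⟨T'.sum, (map_multiset_sum φ T').symm⟩
  have hns' : ∀ T : Multiset G, T ≤ W → T.sum = 0 → T = 0 := by
    intro T hT hs
    rcases hA.2.2.2 T (hT.trans (Multiset.le_cons_self _ _)) hs with h | h
    · exact h
    · have := Multiset.card_le_card hT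
      rw [h, Multiset.card_cons] at this; omega
  have hs0 : φ u + W.sum = 0 := by simpa using hA.sum
  refine ⟨(φ u + g) ::ₘ (-g) ::ₘ W, Atom.mk' (by simp) ?_ ?_, by simp [hW]⟩
  · simp only [Multiset.sum_cons]
    rw [← hs0]; abel
  · intro T hT hTs
    have hng : ∀ y z : H, φ y + g = φ z → False := by
      intro y z h
      exact hg (z - y) (by rw [map_sub, ← h]; abel)
    by_cases h1 : (φ u + g) ∈ T
    · obtain ⟨T1, rfl⟩ := Multiset.exists_cons_of_mem h1
      have hT1 := (Multiset.cons_le_cons_iff _).1 hT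
      by_cases h2 : (-g) ∈ T1
      · obtain ⟨T2, rfl⟩ := Multiset.exists_cons_of_mem h2
        have hT2 := (Multiset.cons_le_cons_iff _).1 hT1
        right
        have : φ u ::ₘ T2 = φ u ::ₘ W := hA.eq_of_le (Multiset.cons_le_cons _ hT2) (by simp) (by
          simp only [Multiset.sum_cons] at hTs ⊢
          rw [← hTs]; abel)
        rw [(Multiset.cons_inj_right _).1 this]
      · have hT2 := (Multiset.le_cons_of_notMem h2).1 hT1
        obtain ⟨y, hy⟩ := hWr T1 hT2
        simp only [Multiset.sum_cons] at hTs
        exact (hng (u + y) 0 (by rw [map_zero, map_add, ← hTs, hy]; abel)).elim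
    · have hT1 := (Multiset.le_cons_of_notMem h1).1 hT
      by_cases h2 : (-g) ∈ T
      · obtain ⟨T2, rfl⟩ := Multiset.exists_cons_of_mem h2
        have hT2 := (Multiset.cons_le_cons_iff _).1 hT1
        obtain ⟨y, hy⟩ := hWr T2 hT2
        simp only [Multiset.sum_cons, hy] at hTs
        exact (hng 0 y (by rw [map_zero, zero_add, ← sub_eq_zero, ← neg_eq_zero, ← hTs]; abel)).elim
      · left; exact hns' T ((Multiset.le_cons_of_notMem h2).1 hT1) hTs

/-- A strict embedding cannot preserve the system of sets of lengths. -/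
lemma strict_embed {A B : Type*} [AddCommGroup A] [Fintype A] [AddCommGroup B]
    (hL : systemL (Set.univ : Set A) = systemL (Set.univ : Set B)) {φ : A →+ B}
    (hφ : Function.Injective φ) (hns : ¬ Function.Surjective φ) {g : A} (hg : 2 ≤ addOrderOf g) :
    False := by
  have hex : ∃ k, ∀ U : Multiset A, Atom U → Multiset.card U ≤ k := ⟨_, fun U hU => atom_card_le hU⟩
  have hspec := Nat.find_spec hex
  obtain ⟨U, hU, hUc⟩ : ∃ U : Multiset A, Atom U ∧ Nat.find hex = Multiset.card U := by
    by_contra hcon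
    push Not at hcon
    have h1 := hspec (pw g) (pw_atom g)
    rw [pw, Multiset.card_replicate] at h1
    refine Nat.find_min hex (m := Nat.find hex - 1) (by omega) ?_
    intro U hU
    have h2 := hspec U hU
    have h3 := hcon U hU
    omega
  have hU2 : 2 ≤ Multiset.card U := by
    have h1 := hspec (pw g) (pw_atom g)
    rw [pw, Multiset.card_replicate] at h1
    omega
  obtain ⟨V, hV, hVc⟩ := atom_extend hφ hns hU
  have hY := yy_of_atom hV (by omega)
  rw [← hL] at hY
  obtain ⟨W, hW, hWc⟩ := atom_of_yy (by omega) hY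
  have := hspec W hW
  omega

/-- Comparison of a homocyclic group with a group of larger rank. -/
lemma embed_contra {A B : Type*} [AddCommGroup A] [Fintype A] [AddCommGroup B] [Fintype B]
    {n mA mB k rB : ℕ} (hA : GD A n mA k) (hB : GD B n mB rB) (hk : k < rB) (hn : 3 ≤ n)
    (hL : systemL (Set.univ : Set A) = systemL (Set.univ : Set B))
    {α : (Fin k → ZMod n) →+ A} (hα : Function.Injective α)
    {β : (Fin k → ZMod n) →+ B} (hβ : Function.Injective β) : False := by
  haveI : NeZero n := ⟨by omega⟩
  have hbij : Function.Bijective α := by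
    rw [Fintype.bijective_iff_injective_and_card]
    refine ⟨hα, le_antisymm (Fintype.card_le_of_injective α hα) ?_⟩
    have := hA.hcard
    simpa [Fintype.card_pi, ZMod.card] using this
  let e := AddEquiv.ofBijective α hbij
  let φ : A →+ B := β.comp e.symm.toAddMonoidHom
  have hφ : Function.Injective φ := hβ.comp e.symm.injective
  obtain ⟨g, hg⟩ := hA.hord
  refine strict_embed hL hφ ?_ (g := g) (by omega)
  intro hsurj
  let e2 := AddEquiv.ofBijective φ ⟨hφ, hsurj⟩
  obtain ⟨ψ, hψ⟩ := hB.hom (k + 1) hk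
  have := rank_le_of_hom (φ := e2.symm.toAddMonoidHom.comp ψ) hB.hm hA.htor
    (e2.symm.injective.comp hψ)
  omega

end Data

open scoped Classical

section Final

lemma quad_zmod4_one : ∀ a b c d : ZMod 4, a + b + c + d = 0 ∧ a ≠ 0 ∧ b ≠ 0 ∧ c ≠ 0 ∧ d ≠ 0 ∧
    b + c ≠ 0 ∧ b + d ≠ 0 ∧ c + d ≠ 0 → (a = 1 ∨ a = -1) := by
  decide

lemma quad_zmod4 (a b c d : ZMod 4) (hs : a + b + c + d = 0) (ha : a ≠ 0) (hb : b ≠ 0)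
    (hc : c ≠ 0) (hd : d ≠ 0)
    (hab : a + b ≠ 0) (hac : a + c ≠ 0) (had : a + d ≠ 0) (hbc : b + c ≠ 0) (hbd : b + d ≠ 0)
    (hcd : c + d ≠ 0) :
    (a = 1 ∨ a = -1) ∧ (b = 1 ∨ b = -1) ∧ (c = 1 ∨ c = -1) ∧ (d = 1 ∨ d = -1) :=
  ⟨quad_zmod4_one a b c d ⟨hs, ha, hb, hc, hd, hbc, hbd, hcd⟩,
    quad_zmod4_one b a c d ⟨by rw [← hs]; ring, hb, ha, hc, hd, hac, had, hcd⟩,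
    quad_zmod4_one c a b d ⟨by rw [← hs]; ring, hc, ha, hb, hd, hab, had, hbd⟩,
    quad_zmod4_one d a b c ⟨by rw [← hs]; ring, hd, ha, hb, hc, hab, hac, hbc⟩⟩

lemma zmod4_atom {U : Multiset (ZMod 4)} (hU : Atom U) :
    2 ≤ Multiset.card U + U.count 0 ∧ Multiset.card U + U.count 0 ≤ 4 ∧
    (Multiset.card U + U.count 0 = 4 → Over ({1, -1} : Set (ZMod 4)) U) := by
  by_cases h0 : (0 : ZMod 4) ∈ U
  · rw [hU.zero_mem h0]; simp
  · have h1 := hU.two_le h0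
    have h2 := atom_card_le hU
    rw [ZMod.card] at h2
    rw [Multiset.count_eq_zero_of_notMem h0]
    refine ⟨by omega, by omega, ?_⟩
    intro h4
    rw [add_zero] at h4
    obtain ⟨a, V, rfl⟩ : ∃ a V, U = a ::ₘ V :=
      ⟨_, _, (Multiset.exists_cons_of_mem (Multiset.exists_mem_of_ne_zero hU.ne_zero).choose_spec).choose_spec⟩
    obtain ⟨b, c, d, rfl⟩ := Multiset.card_eq_three.1 (by simpa using h4 : Multiset.card V = 3)
    have hs := hU.sum
    simp only [Multiset.sum_cons, Multiset.insert_eq_cons, Multiset.sum_singleton] at hs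
    have key : ∀ x y : ZMod 4, ({x, y} : Multiset (ZMod 4)) ≤ a ::ₘ {b, c, d} → x + y ≠ 0 := by
      intro x y hle h
      have := hU.eq_of_le hle (by simp) (by simpa using h)
      have := congrArg Multiset.card this
      simp at this
    have lecons : ∀ {x : ZMod 4} {s t : Multiset (ZMod 4)}, s ≤ t → s ≤ x ::ₘ t :=
      fun h => h.trans (Multiset.le_cons_self _ _)
    have lc : ∀ {x : ZMod 4} {s t : Multiset (ZMod 4)}, s ≤ t → x ::ₘ s ≤ x ::ₘ t :=
      fun h => Multiset.cons_le_cons _ h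
    have l0 : ∀ {t : Multiset (ZMod 4)}, (0 : Multiset (ZMod 4)) ≤ t := Multiset.zero_le _
    simp only [Multiset.mem_cons, Multiset.insert_eq_cons, Multiset.mem_singleton, not_or] at h0
    have := quad_zmod4 a b c d (by rw [← hs]; ring) (Ne.symm h0.1) (Ne.symm h0.2.1)
      (Ne.symm h0.2.2.1) (Ne.symm h0.2.2.2)
      (key a b (lc (lc l0)))
      (key a c (lc (lecons (lc l0))))
      (key a d (lc (lecons (lecons (lc l0)))))
      (key b c (lecons (lc (lc l0))))
      (key b d (lecons (lc (lecons (lc l0)))))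
      (key c d (lecons (lecons (lc (lc l0)))))
    intro x hx
    simp only [Multiset.mem_cons, Multiset.insert_eq_cons, Multiset.mem_singleton] at hx
    rcases hx with rfl | rfl | rfl | rfl
    · exact this.1
    · exact this.2.1
    · exact this.2.2.1
    · exact this.2.2.2

lemma zmod4_no {B : Multiset (ZMod 4)} (h3 : HasLen B 3) (h4 : HasLen B 4) (h6 : HasLen B 6) :
    False := by
  have hB : Over ({1, -1} : Set (ZMod 4)) B := by
    obtain ⟨F, hF, hs, hc⟩ := h6
    have low : ∀ F : Multiset (Multiset (ZMod 4)), Fctn F →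
        2 * Multiset.card F ≤ Multiset.card F.sum + F.sum.count 0 := by
      intro F
      induction F using Multiset.induction_on with
      | empty => simp
      | cons U F ih =>
        intro hF
        have h1 := ih (hF.mono (Multiset.le_cons_self _ _))
        have h2 := (zmod4_atom (hF U (by simp))).1
        simp only [Multiset.card_cons, Multiset.sum_cons, Multiset.card_add, Multiset.count_add]
        omega
    have h1 := low F hF
    rw [hs, hc] at h1
    obtain ⟨F', hF', rfl, hc'⟩ := h3
    obtain ⟨U, V, W, rfl⟩ := Multiset.card_eq_three.1 hc'
    have hU := zmod4_atom (hF' U (by simp))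
    have hV := zmod4_atom (hF' V (by simp))
    have hW := zmod4_atom (hF' W (by simp))
    simp only [Multiset.sum_cons, Multiset.insert_eq_cons, Multiset.sum_singleton,
      Multiset.card_add, Multiset.count_add] at h1 ⊢
    intro x hx
    rcases Multiset.mem_add.1 hx with h | h
    · exact hU.2.2 (by omega) x h
    rcases Multiset.mem_add.1 h with h | h
    · exact hV.2.2 (by omega) x h
    · exact hW.2.2 (by omega) x h
  have := modd_pm (g := (1 : ZMod 4)) (ZMod.addOrderOf_one 4) (by norm_num) B 4 3 hB h4 h3
  norm_num at this

lemma atom_quad {H : Type*} [AddCommGroup H] {a b c d : H} (hs : a + b + c + d = 0)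
    (ha : a ≠ 0) (hb : b ≠ 0) (hc : c ≠ 0) (hd : d ≠ 0) (hab : a + b ≠ 0) (hac : a + c ≠ 0)
    (had : a + d ≠ 0) (hbc : b + c ≠ 0) (hbd : b + d ≠ 0) (hcd : c + d ≠ 0) :
    Atom ({a, b, c, d} : Multiset H) := by
  have h3 : ∀ {x y : H}, x + y = 0 → x ≠ 0 → y ≠ 0 := by
    rintro x y h1 h2 rfl; exact h2 (by simpa using h1)
  have h234 : b + (c + d) ≠ 0 := h3 (x := a) (by rw [← hs]; abel) ha
  have h134 : a + (c + d) ≠ 0 := h3 (x := b) (by rw [← hs]; abel) hb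
  have h124 : a + (b + d) ≠ 0 := h3 (x := c) (by rw [← hs]; abel) hc
  have h123 : a + (b + c) ≠ 0 := h3 (x := d) (by rw [← hs]; abel) hd
  refine ⟨by simp, fun _ _ => trivial, by simpa [add_assoc] using hs, ?_⟩
  intro T hT hTs
  rw [← Multiset.mem_powerset] at hT
  simp only [Multiset.insert_eq_cons, ← Multiset.cons_zero, Multiset.powerset_cons,
    Multiset.powerset_zero, Multiset.map_add, Multiset.map_cons, Multiset.map_zero,
    Multiset.mem_add, Multiset.mem_cons, Multiset.notMem_zero, or_false] at hT
  rcases hT with (((hT | hT) | (hT | hT)) | ((hT | hT) | (hT | hT))) |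
    (((hT | hT) | (hT | hT)) | ((hT | hT) | (hT | hT))) <;> subst hT <;>
    simp_all [Multiset.insert_eq_cons]

lemma c2cube (L : Set (Set ℕ)) (hL : systemL (Set.univ : Set (Fin 3 → ZMod 2)) ⊆ L) :
    ∃ l ∈ L, 3 ∈ l ∧ 4 ∈ l ∧ 6 ∈ l := by
  let a : Fin 3 → ZMod 2 := ![1, 0, 0]
  let b : Fin 3 → ZMod 2 := ![0, 1, 0]
  let ab : Fin 3 → ZMod 2 := ![1, 1, 0]
  let ac : Fin 3 → ZMod 2 := ![1, 0, 1]
  let bc : Fin 3 → ZMod 2 := ![0, 1, 1]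
  let abc : Fin 3 → ZMod 2 := ![1, 1, 1]
  have h1 : Atom ({a, ab, ac, abc} : Multiset (Fin 3 → ZMod 2)) := by
    apply atom_quad <;> decide
  have h2 : Atom ({b, ab, bc, abc} : Multiset (Fin 3 → ZMod 2)) := by
    apply atom_quad <;> decide
  have h3 : Atom ({a, b, ac, bc} : Multiset (Fin 3 → ZMod 2)) := by
    apply atom_quad <;> decide
  have hp : ∀ x : Fin 3 → ZMod 2, x ≠ 0 → HasLen ({x, x} : Multiset (Fin 3 → ZMod 2)) 1 := by
    intro x hx
    have e : -x = x := by revert x; decide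
    have := atom_pair hx
    rw [e] at this
    exact HasLen.atom this
  have l3 := ((HasLen.atom h1).add (HasLen.atom h2)).add (HasLen.atom h3)
  have l4 := ((HasLen.atom h1).add (HasLen.atom h1)).add
    ((hp b (by decide)).add (hp bc (by decide)))
  have l6 := (((hp a (by decide)).add (hp b (by decide))).add
    ((hp ab (by decide)).add (hp ac (by decide)))).add
    ((hp bc (by decide)).add (hp abc (by decide)))
  refine ⟨_, hL ⟨_, ⟨fun _ _ => trivial, l3.sum_eq⟩, rfl⟩, mem_lengthSet.2 l3,
    mem_lengthSet.2 ?_, mem_lengthSet.2 ?_⟩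
  · convert l4 using 1
    simp only [Multiset.insert_eq_cons, ← Multiset.singleton_add]; abel
  · convert l6 using 1
    simp only [Multiset.insert_eq_cons, ← Multiset.singleton_add]; abel

lemma cyc_hom {G : Type*} [AddCommGroup G] [Fintype G] {n : ℕ} (hn : 0 < n) (hexp : ∀ g : G, n • g = 0)
    (hg : ∃ g : G, addOrderOf g = n) :
    ∃ φ : (Fin 1 → ZMod n) →+ G, Function.Injective φ := by
  obtain ⟨g, hg⟩ := hg
  haveI : NeZero n := ⟨hn.ne'⟩
  refine ⟨powHom hexp (fun _ => g), ?_⟩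
  rw [injective_iff_map_eq_zero]
  intro x hx
  rw [powHom_apply] at hx
  simp only [Finset.univ_unique, Finset.sum_singleton, Fin.default_eq_zero] at hx
  have h1 := addOrderOf_dvd_of_nsmul_eq_zero hx
  rw [hg] at h1
  have h2 := Nat.eq_zero_of_dvd_of_lt h1 (ZMod.val_lt _)
  funext i
  rw [Fin.fin_one_eq_zero i]
  exact (ZMod.val_eq_zero _).1 h2

lemma gd_xx2 {G : Type*} [AddCommGroup G] [Fintype G] {n m r d : ℕ} (h : GD G n m r)
    (hd : 1 ≤ d) (hdr : d + 1 ≤ r) : XX2 d (systemL (Set.univ : Set G)) := by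
  obtain ⟨φ, hφ⟩ := h.hom (d + 1) hdr
  exact (xx2_basis hd h.hm).mono (systemL_sub hφ)

lemma gd_xx {G : Type*} [AddCommGroup G] [Fintype G] {n m r : ℕ} (h : GD G n m r)
    (hn : 3 ≤ n) : XX (n - 2) (systemL (Set.univ : Set G)) := by
  obtain ⟨g, hg⟩ := h.hord
  exact deltaStar_xx (exp_mem_deltaStar hg hn)

lemma gd_exp {G : Type*} [AddCommGroup G] [Fintype G] {n m r : ℕ} (h : GD G n m r) :
    AddMonoid.exponent G = n := by
  obtain ⟨g, hg⟩ := h.hord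
  refine Nat.dvd_antisymm (AddMonoid.exponent_dvd_of_forall_nsmul_eq_zero h.hexp) ?_
  rw [← hg]
  exact AddMonoid.addOrder_dvd_exponent g

/-- The case of exponent 4 and rank 1. -/
lemma case_four {A B : Type*} [AddCommGroup A] [Fintype A] [AddCommGroup B] [Fintype B]
    {m n' m' r' : ℕ} (hA : GD A 4 m 1) (hB : GD B n' m' r') (h2 : 2 ≤ r') (hn' : n' ≤ 4)
    (hL : systemL (Set.univ : Set A) = systemL (Set.univ : Set B)) : False := by
  obtain ⟨α, hα⟩ := cyc_hom hA.hn hA.hexp hA.hord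
  have hm2 := hB.hm
  have hm' := Nat.le_of_dvd hB.hn hB.hmn
  have hx := gd_xx hA (by norm_num)
  rw [hL] at hx
  have hx := xx_bound hB.hn hB.hexp hB.htor hx
  have hcard := hA.hcard
  obtain rfl | rfl | rfl : n' = 4 ∨ n' = 3 ∨ n' = 2 := by omega
  · obtain ⟨β, hβ⟩ := cyc_hom hB.hn hB.hexp hB.hord
    exact embed_contra hA hB h2 (by norm_num) hL hα hβ
  · have hm3 : m' = 3 := by
      have := (Nat.dvd_prime Nat.prime_three).1 hB.hmn
      omega
    subst hm3
    obtain ⟨φ, hφ⟩ := hB.hom 2 h2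
    obtain ⟨V, -, hV, hc⟩ := basis_atom (d := 1) (m := 3) le_rfl (by norm_num)
    have hV' := (atom_map hφ).2 hV
    have hc' : Multiset.card (V.map φ) = 5 := by rw [Multiset.card_map, hc]
    have hy := yy_of_atom hV' (by omega)
    rw [hc', ← hL] at hy
    obtain ⟨U, hU, h5⟩ := atom_of_yy (by norm_num) hy
    have := atom_card_le hU
    omega
  · have hm3 : m' = 2 := by omega
    subst hm3
    obtain ⟨φ, hφ⟩ := hB.hom 3 (by omega)
    obtain ⟨l, hl, h3, h4, h6⟩ := c2cube _ (systemL_sub hφ)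
    rw [← hL] at hl
    have hbij : Function.Bijective α := by
      rw [Fintype.bijective_iff_injective_and_card]
      refine ⟨hα, le_antisymm (Fintype.card_le_of_injective α hα) ?_⟩
      simpa [Fintype.card_pi, ZMod.card] using hcard
    let e := AddEquiv.ofBijective α hbij
    let ψ : A →+ ZMod 4 := (Pi.evalAddMonoidHom (fun _ : Fin 1 => ZMod 4) 0).comp
      e.symm.toAddMonoidHom
    have hψ : Function.Injective ψ := by
      intro x y hxy
      apply e.symm.injective
      funext i
      rw [Fin.fin_one_eq_zero i]
      exact hxy
    obtain ⟨C, -, rfl⟩ := systemL_sub hψ hl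
    exact zmod4_no (mem_lengthSet.1 h3) (mem_lengthSet.1 h4) (mem_lengthSet.1 h6)

/-- The case of equal exponents. -/
lemma case_eq {A B : Type*} [AddCommGroup A] [Fintype A] [AddCommGroup B] [Fintype B]
    {n mA mB rA rB : ℕ} (hA : GD A n mA rA) (hB : GD B n mB rB) (hr : rA < rB)
    (hr0 : 0 < rA) (hrn : rB + 3 ≤ n)
    (hL : systemL (Set.univ : Set A) = systemL (Set.univ : Set B))
    (hx : XX (n / 2) (systemL (Set.univ : Set A))) : False := by
  by_cases h : n < 2 * rB
  · have h2 := gd_xx2 hB (d := rB - 1) (by omega) (by omega)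
    rw [← hL] at h2
    exact not_xx2 hA.hn hA.hexp hA.htor (by omega) (by omega) (by omega) h2
  · obtain ⟨α, hα⟩ := xx_hom hA.hn hA.hexp hA.htor (by omega) (by omega) hx
    rw [hL] at hx
    obtain ⟨β, hβ⟩ := xx_hom hB.hn hB.hexp hB.htor (by omega) (by omega) hx
    have h1 := rank_le_of_hom (by omega) hA.htor hα
    have h2 : n - n / 2 - 1 = rA := by omega
    subst h2
    exact embed_contra hA hB hr (by omega) hL hα hβ

end Final

/-- If `G ≅ C_{n₁} ⊕ … ⊕ C_{n_r}` with `1 < n₁ ∣ … ∣ n_r`,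
`D(G) ≥ 4`, `𝓛(G) = 𝓛(G')`, `r ≤ n_r − 3` and `Δ*(G)` is an interval, then
`exp(G) = exp(G')` and `r(G) = r(G')`. -/
theorem stmt6 {G G' : Type*} [AddCommGroup G] [Fintype G] [AddCommGroup G'] [Fintype G']
    (r : ℕ) (hr : 0 < r) (n : Fin r → ℕ) (hn : ∀ i, 1 < n i)
    (hdvd : ∀ i j : Fin r, i ≤ j → n i ∣ n j)
    (hG : Nonempty (G ≃+ (∀ i : Fin r, ZMod (n i))))
    (r' : ℕ) (hr' : 0 < r') (n' : Fin r' → ℕ) (hn' : ∀ i, 1 < n' i)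
    (hdvd' : ∀ i j : Fin r', i ≤ j → n' i ∣ n' j)
    (hG' : Nonempty (G' ≃+ (∀ i : Fin r', ZMod (n' i))))
    (hD : 4 ≤ davenport G)
    (hL : systemL (Set.univ : Set G) = systemL (Set.univ : Set G'))
    (hcond : r ≤ n ⟨r - 1, by omega⟩ - 3)
    (hint : ∀ a b c : ℕ, a ∈ deltaStar G → c ∈ deltaStar G → a ≤ b → b ≤ c →
      b ∈ deltaStar G) :
    AddMonoid.exponent G = AddMonoid.exponent G' ∧ r = r' := by
  have hGD := GD_of r hr n hn hdvd hG
  have hGD' := GD_of r' hr' n' hn' hdvd' hG'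
  generalize n ⟨r - 1, by omega⟩ = N at *
  generalize n' ⟨r' - 1, by omega⟩ = N' at *
  generalize n ⟨0, hr⟩ = m at *
  generalize n' ⟨0, hr'⟩ = m' at *
  have hN : r + 3 ≤ N := by omega
  have hN' : N' ≤ N := by
    by_contra hcon
    have h := gd_xx hGD' (by omega)
    rw [← hL] at h
    have := xx_bound hGD.hn hGD.hexp hGD.htor h
    omega
  have hx := gd_xx hGD (by omega)
  have hx' := hx
  rw [hL] at hx'
  have hb := xx_bound hGD'.hn hGD'.hexp hGD'.htor hx'
  have hrr : r' + 3 ≤ N := by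
    by_contra hcon
    by_cases h4 : N = 4
    · subst h4
      have hr1 : r = 1 := by omega
      subst hr1
      exact case_four hGD hGD' (by omega) hN' hL
    · have h2 := gd_xx2 hGD' (d := N - 3) (by omega) (by omega)
      rw [← hL] at h2
      exact not_xx2 hGD.hn hGD.hexp hGD.htor (by omega) (by omega) (by omega) h2
  have hNN : N' = N := by omega
  subst hNN
  refine ⟨by rw [gd_exp hGD, gd_exp hGD'], ?_⟩
  obtain ⟨g, hg⟩ := hGD.hord
  have hhalf : XX (N' / 2) (systemL (Set.univ : Set G)) :=
    deltaStar_xx (hint 1 (N' / 2) (N' - 2) (one_mem_deltaStar (g := g) (by omega))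
      (exp_mem_deltaStar hg (by omega)) (by omega) (by omega))
  rcases lt_trichotomy r r' with h | h | h
  · exact (case_eq hGD hGD' h hr hrr hL hhalf).elim
  · exact h
  · rw [hL] at hhalf
    exact (case_eq hGD' hGD h hr' hN hL.symm hhalf).elim
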